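/- Let G be a finite insoluble biminimal non-abelian group. Then G is isomorphic to the alternating group A₅. -/

import Mathlib

/-- A group is *minimal non-nilpotent* if it is not nilpotent but every proper
subgroup of it is nilpotent. -/
def MinimalNonNilpotent (G : Type*) [Group G] : Prop :=
  ¬ Group.IsNilpotent G ∧ ∀ H : Subgroup G, H ≠ ⊤ → Group.IsNilpotent H

/-- A group is *biminimal non-nilpotent* if it is neither nilpotent nor minimal
non-nilpotent, but every proper subgroup of it is nilpotent or minimal non-nilpotent. -/
def BiminimalNonNilpotent (G : Type*) [Group G] : Prop :=
  ¬ Group.IsNilpotent G ∧ ¬ MinimalNonNilpotent G ∧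
    ∀ H : Subgroup G, H ≠ ⊤ → (Group.IsNilpotent H ∨ MinimalNonNilpotent H)

/-- A group is *para-Nil-Hamiltonian* if it is not nilpotent and every non-normal
subgroup of it is either nilpotent or minimal non-nilpotent. -/
def ParaNilHamiltonian (G : Type*) [Group G] : Prop :=
  ¬ Group.IsNilpotent G ∧
    ∀ H : Subgroup G, ¬ H.Normal → (Group.IsNilpotent H ∨ MinimalNonNilpotent H)

/-- A group is *meta-Nil-Hamiltonian* if every non-nilpotent subgroup of it is normal. -/
def MetaNilHamiltonian (G : Type*) [Group G] : Prop :=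
  ∀ H : Subgroup G, ¬ Group.IsNilpotent H → H.Normal

/-- A group is *locally graded* if every non-trivial finitely generated subgroup of it
contains a proper subgroup of finite index. -/
def LocallyGraded (G : Type*) [Group G] : Prop :=
  ∀ H : Subgroup G, H ≠ ⊥ → Group.FG H → ∃ K : Subgroup H, K ≠ ⊤ ∧ K.FiniteIndex

/-- A group is abelian if its multiplication commutes. -/
def Abelian (G : Type*) [Group G] : Prop := ∀ a b : G, a * b = b * a

/-- A group is *minimal non-abelian* if it is not abelian but every proper
subgroup of it is abelian. -/
def MinimalNonAbelian (G : Type*) [Group G] : Prop :=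
  ¬ Abelian G ∧ ∀ H : Subgroup G, H ≠ ⊤ → Abelian H

/-- A group is *biminimal non-abelian* if it is neither abelian nor minimal non-abelian,
but every proper subgroup of it is abelian or minimal non-abelian. -/
def BiminimalNonAbelian (G : Type*) [Group G] : Prop :=
  ¬ Abelian G ∧ ¬ MinimalNonAbelian G ∧
    ∀ H : Subgroup G, H ≠ ⊤ → (Abelian H ∨ MinimalNonAbelian H)

/-- A group is *parahamiltonian* if it is not abelian and every non-normal subgroup
of it is either abelian or minimal non-abelian. -/
def Parahamiltonian (G : Type*) [Group G] : Prop :=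
  ¬ Abelian G ∧ ∀ H : Subgroup G, ¬ H.Normal → (Abelian H ∨ MinimalNonAbelian H)

/-- A group is *locally nilpotent* if every finitely generated subgroup of it is nilpotent. -/
def LocallyNilpotent (G : Type*) [Group G] : Prop :=
  ∀ H : Subgroup G, Group.FG H → Group.IsNilpotent H

open Matrix in
/-- A complete system of irreducible complex matrix representations of a finite group,
recorded through second orthogonality and linear independence of the characters. -/
structure CharTable (G : Type*) [Group G] [Fintype G] [DecidableEq G] where
  k : ℕ
  d : Fin k → ℕ
  rep : ∀ i, G →* Matrix (Fin (d i)) (Fin (d i)) ℂ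
  d_pos : ∀ i, 0 < d i
  col : ∀ x y : G, ∑ i, (rep i x).trace * (rep i y⁻¹).trace =
    ∑ h : G, if x * h = h * y then (1 : ℂ) else 0
  indep : LinearIndependent ℂ (fun i (x : G) => (rep i x).trace)

theorem Matrix.trace_mulLeftRight {n : Type*} [Fintype n] [DecidableEq n] (X Y : Matrix n n ℂ) :
    LinearMap.trace ℂ (Matrix n n ℂ) (LinearMap.mulLeftRight ℂ (X, Y)) = X.trace * Y.trace := by
  rw [LinearMap.trace_eq_matrix_trace ℂ (Matrix.stdBasis ℂ n n)]
  simp only [Matrix.trace, Matrix.diag, LinearMap.toMatrix_apply, LinearMap.mulLeftRight_apply]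
  rw [Fintype.sum_prod_type, Finset.sum_mul_sum]
  refine Finset.sum_congr rfl fun i _ => Finset.sum_congr rfl fun j _ => ?_
  rw [Matrix.stdBasis_eq_single]
  have : ∀ (M : Matrix n n ℂ), (Matrix.stdBasis ℂ n n).repr M (i, j) = M i j := by
    intro M
    simp [Matrix.stdBasis]
  rw [this]
  simp [Matrix.mul_apply, Matrix.single_apply, ite_and]

theorem LinearMap.trace_pi_diagonal {η : Type*} [Fintype η] [DecidableEq η] {M : η → Type*}
    [∀ i, AddCommGroup (M i)] [∀ i, Module ℂ (M i)] [∀ i, FiniteDimensional ℂ (M i)]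
    (f : ∀ i, M i →ₗ[ℂ] M i) :
    LinearMap.trace ℂ (∀ i, M i) (LinearMap.pi fun i => f i ∘ₗ LinearMap.proj i) =
      ∑ i, LinearMap.trace ℂ (M i) (f i) := by
  let b : ∀ i, Module.Basis _ ℂ (M i) := fun i => Module.finBasis ℂ (M i)
  rw [LinearMap.trace_eq_matrix_trace ℂ (Pi.basis b)]
  simp only [Matrix.trace, Matrix.diag, LinearMap.toMatrix_apply, Fintype.sum_sigma]
  refine Finset.sum_congr rfl fun i _ => ?_
  rw [LinearMap.trace_eq_matrix_trace ℂ (b i)]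
  simp [Matrix.trace, LinearMap.toMatrix_apply, Pi.basis_apply, Pi.basis_repr]

theorem CharTable.nonempty (G : Type*) [Group G] [Fintype G] [DecidableEq G] :
    Nonempty (CharTable G) := by
  obtain ⟨k, d, hd, ⟨e⟩⟩ :=
    IsSemisimpleRing.exists_algEquiv_pi_matrix_of_isAlgClosed ℂ (MonoidAlgebra ℂ G)
  let rep : ∀ i, G →* Matrix (Fin (d i)) (Fin (d i)) ℂ := fun i =>
    ((Pi.evalMonoidHom (fun i => Matrix (Fin (d i)) (Fin (d i)) ℂ) i).comp
      (e : MonoidAlgebra ℂ G →* _)).comp (MonoidAlgebra.of ℂ G)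
  have hrep : ∀ i x, rep i x = e (MonoidAlgebra.of ℂ G x) i := fun _ _ => rfl
  refine ⟨⟨k, d, rep, fun i => Nat.pos_of_ne_zero (hd i).out, ?_, ?_⟩⟩
  · intro x y
    let f : MonoidAlgebra ℂ G →ₗ[ℂ] MonoidAlgebra ℂ G :=
      LinearMap.mulLeftRight ℂ (MonoidAlgebra.of ℂ G x, MonoidAlgebra.of ℂ G y⁻¹)
    have h1 : LinearMap.trace ℂ _ f = ∑ h : G, if x * h = h * y then (1 : ℂ) else 0 := by
      rw [LinearMap.trace_eq_matrix_trace ℂ (MonoidAlgebra.basis G ℂ)]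
      simp only [Matrix.trace, Matrix.diag, LinearMap.toMatrix_apply]
      refine Finset.sum_congr rfl fun h _ => ?_
      simp [f, MonoidAlgebra.basis, MonoidAlgebra.single_mul_single, Finsupp.single_apply,
        mul_inv_eq_iff_eq_mul]
    have h2 : LinearMap.trace ℂ _ f = ∑ i, (rep i x).trace * (rep i y⁻¹).trace := by
      rw [← LinearMap.trace_conj' f e.toLinearEquiv]
      have h3 : e.toLinearEquiv.conj f =
          LinearMap.pi fun i => LinearMap.mulLeftRight ℂ (rep i x, rep i y⁻¹) ∘ₗ
            LinearMap.proj i := by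
        refine LinearMap.ext fun a => ?_
        funext i
        simp only [f, LinearEquiv.conj_apply_apply, LinearMap.mulLeftRight_apply,
          LinearMap.pi_apply,
          LinearMap.comp_apply, LinearMap.proj_apply, hrep]
        change e (MonoidAlgebra.of ℂ G x * e.symm a * MonoidAlgebra.of ℂ G y⁻¹) i = _
        rw [map_mul, map_mul, e.apply_symm_apply]
        rfl
      rw [h3, LinearMap.trace_pi_diagonal]
      exact Finset.sum_congr rfl fun i _ => Matrix.trace_mulLeftRight _ _
    rw [← h1, h2]
  · rw [Fintype.linearIndependent_iff]
    intro c hc i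
    let φ : MonoidAlgebra ℂ G →ₗ[ℂ] ℂ :=
      ∑ j, c j • (Matrix.traceLinearMap (Fin (d j)) ℂ ℂ ∘ₗ LinearMap.proj j ∘ₗ e.toLinearMap)
    have hφ : φ = 0 := by
      apply (MonoidAlgebra.basis G ℂ).ext
      intro x
      have := congrFun hc x
      simpa [φ, MonoidAlgebra.basis, hrep] using this
    have := congrArg (fun ψ => ψ (e.symm (Pi.single i (Matrix.single ⟨0, Nat.pos_of_ne_zero (hd i).out⟩
      ⟨0, Nat.pos_of_ne_zero (hd i).out⟩ 1)))) hφ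
    simp only [φ, LinearMap.sum_apply, LinearMap.smul_apply, LinearMap.comp_apply,
      LinearMap.proj_apply, AlgEquiv.toLinearMap_apply, AlgEquiv.apply_symm_apply,
      Matrix.traceLinearMap_apply, LinearMap.zero_apply] at this
    rw [Finset.sum_eq_single i (fun j _ hj => by simp [Pi.single_eq_of_ne hj]) (by simp)] at this
    simpa [Matrix.trace_single_eq_same] using this

section CharacterTable

open scoped IsMulCommutative

open Matrix in
theorem Matrix.exists_sum_trace_eq {H n : Type*} [Group H] [Fintype H] [Fintype n] [DecidableEq n]
    (ρ : H →* Matrix n n ℂ) : ∃ m : ℕ, ∑ h, (ρ h).trace = Fintype.card H * m := by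
  let R : Representation ℂ H (n → ℂ) :=
    ((Matrix.toLinAlgEquiv' : Matrix n n ℂ ≃ₐ[ℂ] _) : Matrix n n ℂ →* _).comp ρ
  have hc : (Nat.card H : ℂ) ≠ 0 := by simp [Nat.card_eq_fintype_card]
  let _ : Invertible (Nat.card H : ℂ) := invertibleOfNonzero hc
  have h := Representation.card_inv_mul_sum_char_eq_finrank R
  refine ⟨Module.finrank ℂ R.invariants, ?_⟩
  rw [← h, ← Nat.card_eq_fintype_card, ← mul_assoc, mul_inv_cancel₀ hc, one_mul]
  exact Finset.sum_congr rfl fun x _ => (Matrix.trace_toLin'_eq _).symm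

/-- The tensor product of two matrix representations. -/
def Matrix.kroneckerHom {H m n : Type*} [Group H] [Fintype n] [DecidableEq n] [Fintype m]
    [DecidableEq m] (ρ : H →* Matrix m m ℂ) (τ : H →* Matrix n n ℂ) :
    H →* Matrix (m × n) (m × n) ℂ where
  toFun h := Matrix.kroneckerMap (· * ·) (ρ h) (τ h)
  map_one' := by simp
  map_mul' x y := by rw [map_mul, map_mul, Matrix.mul_kronecker_mul]

/-- The contragredient of a matrix representation. -/
def Matrix.contragredient {H m : Type*} [Group H] [Fintype m]
    [DecidableEq m] (ρ : H →* Matrix m m ℂ) : H →* Matrix m m ℂ where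
  toFun h := (ρ h⁻¹).transpose
  map_one' := by simp
  map_mul' x y := by rw [_root_.mul_inv_rev, map_mul, Matrix.transpose_mul]

/-- A scalar-valued homomorphism, as a one-dimensional matrix representation. -/
def Matrix.scalarRep {H : Type*} [Group H] (f : H →* ℂ) : H →* Matrix Unit Unit ℂ :=
  ((Matrix.scalar Unit : ℂ →+* Matrix Unit Unit ℂ) : ℂ →* _).comp f

theorem Matrix.trace_scalarRep {H : Type*} [Group H] (f : H →* ℂ) (h : H) :
    (Matrix.scalarRep f h).trace = f h := by
  simp [Matrix.scalarRep, Matrix.trace]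

theorem Matrix.exists_sum_trace_mul_eq {H m n : Type*} [Group H] [Fintype H] [Fintype n]
    [DecidableEq n] [Fintype m] [DecidableEq m] (ρ : H →* Matrix m m ℂ) (τ : H →* Matrix n n ℂ) :
    ∃ a : ℕ, ∑ h, (ρ h).trace * (τ h).trace = Fintype.card H * a := by
  obtain ⟨a, ha⟩ := Matrix.exists_sum_trace_eq (Matrix.kroneckerHom ρ τ)
  refine ⟨a, ha ▸ Finset.sum_congr rfl fun h _ => ?_⟩
  exact (Matrix.trace_kronecker _ _).symm

theorem Matrix.exists_trace_eq_sum_addChar {A n : Type*} [CommGroup A] [Fintype A] [Fintype n]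
    [DecidableEq n] (ρ : A →* Matrix n n ℂ) :
    ∃ m : AddChar (Additive A) ℂ → ℕ, (∀ a, (ρ a).trace = ∑ ψ, (m ψ : ℂ) * ψ (.ofMul a)) ∧
      ∀ ψ, ∑ h, (ρ h).trace * ψ (-.ofMul h) = Fintype.card A * m ψ := by
  classical
  have key : ∀ ψ : AddChar (Additive A) ℂ, ∃ m : ℕ,
      ∑ h, (ρ h).trace * ψ (-.ofMul h) = Fintype.card A * m := by
    intro ψ
    obtain ⟨m, hm⟩ := Matrix.exists_sum_trace_mul_eq ρ
      (Matrix.scalarRep ⟨⟨fun h => ψ (-.ofMul h), by simp⟩, fun x y => by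
        simp only [ofMul_mul, neg_add, AddChar.map_add_eq_mul]⟩)
    refine ⟨m, hm ▸ Finset.sum_congr rfl fun h _ => ?_⟩
    rw [Matrix.trace_scalarRep]
    rfl
  choose m hm using key
  refine ⟨m, fun a => ?_, hm⟩
  have hc : (Fintype.card A : ℂ) ≠ 0 := by simp
  apply mul_left_cancel₀ hc
  rw [Finset.mul_sum]
  simp_rw [← mul_assoc, ← hm, Finset.sum_mul]
  rw [Finset.sum_comm]
  have : ∀ h : A, ∑ ψ : AddChar (Additive A) ℂ, (ρ h).trace * ψ (-.ofMul h) * ψ (.ofMul a) =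
      if a = h then (Fintype.card A : ℂ) * (ρ a).trace else 0 := by
    intro h
    simp_rw [mul_assoc, ← AddChar.map_add_eq_mul, ← Finset.mul_sum]
    rw [AddChar.sum_apply_eq_ite]
    by_cases hh : a = h
    · subst hh; simp [mul_comm]
    · rw [if_neg, if_neg hh, mul_zero]
      rw [neg_add_eq_zero]
      exact fun h' => hh (Additive.ofMul.injective h').symm
  simp_rw [this]
  simp

theorem Matrix.trace_map_inv_eq_conj {H n : Type*} [Group H] [Fintype H] [Fintype n]
    [DecidableEq n] (ρ : H →* Matrix n n ℂ) (x : H) :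
    (ρ x⁻¹).trace = starRingEnd ℂ (ρ x).trace := by
  classical
  obtain ⟨m, hm, -⟩ := Matrix.exists_trace_eq_sum_addChar
    (A := Subgroup.zpowers x) (ρ.comp (Subgroup.subtype _))
  have h1 := hm ⟨x, Subgroup.mem_zpowers x⟩
  have h2 := hm ⟨x, Subgroup.mem_zpowers x⟩⁻¹
  simp only [MonoidHom.comp_apply, Subgroup.coe_subtype,
          InvMemClass.coe_inv] at h1 h2
  rw [h1, h2, map_sum]
  refine Finset.sum_congr rfl fun ψ _ => ?_
  rw [ofMul_inv, AddChar.map_neg_eq_conj]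
  simp

namespace CharTable

variable {G : Type*} [Group G] [Fintype G] [DecidableEq G] (T : CharTable G)

/-- The characters of the table. -/
def χ (i : Fin T.k) (x : G) : ℂ := (T.rep i x).trace

theorem χ_one (i) : T.χ i 1 = T.d i := by simp [χ, Matrix.trace_one]

theorem χ_one_ne_zero (i) : T.χ i 1 ≠ 0 := by
  rw [χ_one]; exact_mod_cast (T.d_pos i).ne'

theorem χ_mul_comm (i) (x y : G) : T.χ i (x * y) = T.χ i (y * x) := by
  rw [χ, map_mul, Matrix.trace_mul_comm, ← map_mul, ← χ]

theorem χ_conj (i) (x h : G) : T.χ i (h * x * h⁻¹) = T.χ i x := by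
  rw [χ_mul_comm, ← mul_assoc, inv_mul_cancel, one_mul]

theorem χ_conj' (i) (x h : G) : T.χ i (h⁻¹ * x * h) = T.χ i x := by
  simpa using T.χ_conj i x h⁻¹

theorem χ_inv (i) (x : G) : T.χ i x⁻¹ = starRingEnd ℂ (T.χ i x) :=
  Matrix.trace_map_inv_eq_conj _ _

theorem col' (x y : G) : ∑ i, T.χ i x * T.χ i y⁻¹ =
    ∑ h : G, if x * h = h * y then (1 : ℂ) else 0 := T.col x y

theorem indep' : LinearIndependent ℂ T.χ := T.indep

theorem χ_injective : Function.Injective T.χ := T.indep'.injective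

theorem sum_expand (f : G → ℂ) (hf : ∀ h x, f (h⁻¹ * x * h) = f x) (y : G) :
    ∑ j, (∑ x, f x * T.χ j x⁻¹) * T.χ j y = Fintype.card G * f y := by
  simp_rw [Finset.sum_mul]
  rw [Finset.sum_comm]
  have : ∀ x, ∑ j, f x * T.χ j x⁻¹ * T.χ j y =
      ∑ h : G, if y * h = h * x then f x else 0 := by
    intro x
    simp_rw [mul_assoc, mul_comm (T.χ _ x⁻¹), ← Finset.mul_sum, T.col', Finset.mul_sum]
    simp
  simp_rw [this]
  rw [Finset.sum_comm]
  have : ∀ h : G, (∑ x, if y * h = h * x then f x else 0) = f y := by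
    intro h
    rw [Finset.sum_eq_single (h⁻¹ * y * h)]
    · rw [if_pos (by group), hf]
    · intro b _ hb
      rw [if_neg]
      intro h'
      apply hb
      rw [mul_assoc, h']; group
    · simp
  simp [this]

theorem row (i j) : ∑ x, T.χ i x * T.χ j x⁻¹ = if i = j then (Fintype.card G : ℂ) else 0 := by
  have h := T.indep'
  rw [Fintype.linearIndependent_iff] at h
  have := h (fun j => (∑ x, T.χ i x * T.χ j x⁻¹) - if i = j then (Fintype.card G : ℂ) else 0) ?_ j
  · exact sub_eq_zero.mp this
  · funext y
    have := T.sum_expand (T.χ i) (fun h x => T.χ_conj' i x h) y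
    simp [sub_mul, Finset.sum_sub_distrib, this]

theorem exists_eq_of_norm_one {n : Type*} [Fintype n] [DecidableEq n] (ρ : G →* Matrix n n ℂ)
    (hρ : ∑ x, (ρ x).trace * (ρ x⁻¹).trace = Fintype.card G) :
    ∃ j, ∀ x, T.χ j x = (ρ x).trace := by
  have key : ∀ j, ∃ a : ℕ, ∑ x, (ρ x).trace * T.χ j x⁻¹ = Fintype.card G * a := by
    intro j
    obtain ⟨a, ha⟩ := Matrix.exists_sum_trace_mul_eq ρ (Matrix.contragredient (T.rep j))
    refine ⟨a, ha ▸ Finset.sum_congr rfl fun x _ => ?_⟩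
    simp [Matrix.contragredient, χ, Matrix.trace_transpose]
  choose a ha using key
  have hc : (Fintype.card G : ℂ) ≠ 0 := by simp
  have hexp : ∀ y, ∑ j, (a j : ℂ) * T.χ j y = (ρ y).trace := by
    intro y
    have := T.sum_expand (fun x => (ρ x).trace) (fun h x => by
      simp only [map_mul]
      rw [Matrix.trace_mul_comm, ← mul_assoc, ← map_mul]; simp) y
    simp_rw [ha, mul_assoc, ← Finset.mul_sum] at this
    exact mul_left_cancel₀ hc this
  have h1 : ∑ j, a j * a j = 1 := by
    have : (Fintype.card G : ℂ) * ∑ j, (a j : ℂ) * a j = Fintype.card G * 1 := by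
      rw [mul_one]
      refine Eq.trans ?_ hρ
      have h2 : ∀ x : G, (ρ x).trace * (ρ x⁻¹).trace =
          ∑ j, (ρ x).trace * T.χ j x⁻¹ * (a j : ℂ) := fun x => by
        rw [← hexp x⁻¹, Finset.mul_sum]
        exact Finset.sum_congr rfl fun j _ => by ring
      rw [Finset.sum_congr rfl fun x _ => h2 x, Finset.sum_comm, Finset.mul_sum]
      exact Finset.sum_congr rfl fun j _ => by rw [← Finset.sum_mul, ha]; ring
    have := mul_left_cancel₀ hc this
    exact_mod_cast this
  obtain ⟨j, hj⟩ : ∃ j, a j ≠ 0 := by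
    by_contra! h
    simp [h] at h1
  have hj1 : a j * a j + ∑ l ∈ Finset.univ.erase j, a l * a l = 1 := by
    rw [Finset.add_sum_erase _ (fun l => a l * a l) (Finset.mem_univ j), h1]
  have hjpos : 1 ≤ a j * a j := Nat.mul_pos (Nat.pos_of_ne_zero hj) (Nat.pos_of_ne_zero hj)
  have hz : ∑ l ∈ Finset.univ.erase j, a l * a l = 0 := by omega
  have hz' : ∀ l, l ≠ j → a l = 0 := fun l hl => by
    have := (Finset.sum_eq_zero_iff.mp hz) l (by simp [hl])
    simpa using this
  have haj : a j = 1 := by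
    have : a j * a j = 1 := by omega
    exact Nat.eq_one_of_mul_eq_one_right this
  refine ⟨j, fun x => ?_⟩
  rw [← hexp x, Finset.sum_eq_single j (fun l _ hl => by simp [hz' l hl]) (by simp), haj]
  simp

theorem exists_trivial : ∃ i, ∀ x, T.χ i x = 1 := by
  obtain ⟨i, hi⟩ := T.exists_eq_of_norm_one (Matrix.scalarRep (1 : G →* ℂ)) (by
    simp [Matrix.trace_scalarRep])
  exact ⟨i, fun x => by rw [hi, Matrix.trace_scalarRep]; rfl⟩

theorem exists_dual (i) : ∃ j, ∀ x, T.χ j x = T.χ i x⁻¹ := by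
  obtain ⟨j, hj⟩ := T.exists_eq_of_norm_one (Matrix.contragredient (T.rep i)) (by
    have := T.row i i
    rw [if_pos rfl] at this
    rw [← this]
    refine Finset.sum_congr rfl fun x _ => ?_
    simp [Matrix.contragredient, χ, Matrix.trace_transpose, mul_comm])
  refine ⟨j, fun x => ?_⟩
  rw [hj]
  simp [Matrix.contragredient, χ, Matrix.trace_transpose]

/-- The index of the trivial character. -/
noncomputable def triv : Fin T.k := T.exists_trivial.choose

theorem χ_triv (x : G) : T.χ T.triv x = 1 := T.exists_trivial.choose_spec x

/-- The index of the dual character. -/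
noncomputable def dual (i : Fin T.k) : Fin T.k := (T.exists_dual i).choose

theorem χ_dual (i) (x : G) : T.χ (T.dual i) x = T.χ i x⁻¹ := (T.exists_dual i).choose_spec x

theorem dual_dual (i) : T.dual (T.dual i) = i :=
  T.χ_injective (funext fun x => by simp [χ_dual])

theorem dual_triv : T.dual T.triv = T.triv :=
  T.χ_injective (funext fun x => by simp [χ_dual, χ_triv])

theorem dual_eq_self_iff (hodd : Odd (Fintype.card G)) (i) : T.dual i = i ↔ i = T.triv := by
  classical
  have h1 : ∑ i, ∑ x, T.χ i x * T.χ i x = Fintype.card G := by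
    rw [Finset.sum_comm]
    have : ∀ x : G, ∑ i, T.χ i x * T.χ i x = if x = 1 then (Fintype.card G : ℂ) else 0 := by
      intro x
      have h := T.col' x x⁻¹
      rw [inv_inv] at h
      rw [h]
      split_ifs with hx
      · subst hx; simp
      · refine Finset.sum_eq_zero fun h _ => if_neg fun hxh => hx ?_
        have h2 : Commute x (h ^ 2) := by
          have e1 : x = h * x⁻¹ * h⁻¹ := by rw [← hxh]; group
          have e2 : x⁻¹ = h * x * h⁻¹ := by
            have := congrArg (·⁻¹) e1
            simpa [mul_assoc] using this
          have : x = h * (h * x * h⁻¹) * h⁻¹ := by rw [← e2]; exact e1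
          have h' : x * (h * h) = h * h * x := by
            conv_lhs => rw [this]
            group
          show x * h ^ 2 = h ^ 2 * x
          rw [sq, h']
        have ho : Odd (orderOf h) := hodd.of_dvd_nat (orderOf_dvd_card)
        obtain ⟨r, hr⟩ := ho
        have h3 : h = (h ^ 2) ^ (r + 1) := by
          rw [← pow_mul, show 2 * (r + 1) = (2 * r + 1) + 1 by ring, pow_succ, ← hr,
            pow_orderOf_eq_one, one_mul]
        have h4 : Commute x h := by rw [h3]; exact h2.pow_right _
        have h5 : x = x⁻¹ := by
          have : h * x = h * x⁻¹ := by rw [← hxh, h4.eq]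
          exact mul_left_cancel this
        have h6 : x ^ 2 = 1 := by rw [sq]; nth_rw 2 [h5]; simp
        have h7 : orderOf x ∣ 2 := orderOf_dvd_of_pow_eq_one h6
        have h8 : Odd (orderOf x) := hodd.of_dvd_nat (orderOf_dvd_card)
        rcases (Nat.dvd_prime Nat.prime_two).mp h7 with h9 | h9
        · exact orderOf_eq_one_iff.mp h9
        · rw [h9] at h8; exact absurd h8 (by decide)
    simp [this]
  have h2 : ∀ i, ∑ x, T.χ i x * T.χ i x = if T.dual i = i then (Fintype.card G : ℂ) else 0 := by
    intro i
    have := T.row i (T.dual i)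
    simp only [χ_dual, inv_inv] at this
    rw [this]
    simp only [eq_comm]
  simp_rw [h2] at h1
  rw [← Finset.sum_filter, Finset.sum_const, nsmul_eq_mul] at h1
  have hc : (Fintype.card G : ℂ) ≠ 0 := by simp
  have h3 : (Finset.univ.filter fun i => T.dual i = i).card = 1 := by
    have := mul_right_cancel₀ hc (h1.trans (one_mul _).symm)
    exact_mod_cast this
  obtain ⟨j, hj⟩ := Finset.card_eq_one.mp h3
  have ht : T.triv = j := by
    have : T.triv ∈ (Finset.univ.filter fun i => T.dual i = i) := by simp [dual_triv]
    rw [hj] at this; simpa using this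
  rw [ht]
  have : i ∈ (Finset.univ.filter fun i => T.dual i = i) ↔ i ∈ ({j} : Finset _) := by rw [hj]
  simpa using this

end CharTable

theorem card_mul_card_compl_le_of_variance {ι : Type*} [Fintype ι] [DecidableEq ι] (m : ι → ℤ)
    (S : Finset ι) (v : ℤ) (hS : ∀ i, i ∈ S ↔ m i = v) :
    (S.card : ℤ) * (Sᶜ.card : ℤ) ≤
      Fintype.card ι * ∑ i, m i ^ 2 - (∑ i, m i) ^ 2 := by
  have h1 : ∑ i, ∑ j, (m i - m j) ^ 2 = 2 * (Fintype.card ι * ∑ i, m i ^ 2 - (∑ i, m i) ^ 2) := by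
    have : ∀ i j, (m i - m j) ^ 2 = m i ^ 2 - 2 * (m i * m j) + m j ^ 2 := fun i j => by ring
    simp_rw [this, Finset.sum_add_distrib, Finset.sum_sub_distrib, ← Finset.mul_sum,
      ← Finset.sum_mul]
    simp only [Finset.sum_const, Finset.card_univ, nsmul_eq_mul]
    rw [← Finset.mul_sum]
    ring
  have h2 : ∀ i j, (if i ∈ S ∧ j ∈ Sᶜ then (1 : ℤ) else 0) + (if i ∈ Sᶜ ∧ j ∈ S then 1 else 0) ≤
      (m i - m j) ^ 2 := by
    intro i j
    by_cases hi : i ∈ S <;> by_cases hj : j ∈ S <;> simp only [hi, hj, Finset.mem_compl] <;>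
      simp only [not_true, not_false_eq_true, and_true, and_false, if_true, if_false, zero_add,
        add_zero] <;> try positivity
    · have : m i - m j ≠ 0 := fun h => hj ((hS j).2 (by rw [← (hS i).1 hi]; omega))
      have := sq_pos_of_ne_zero this
      omega
    · have : m i - m j ≠ 0 := fun h => hi ((hS i).2 (by rw [← (hS j).1 hj]; omega))
      have := sq_pos_of_ne_zero this
      omega
  have h3 := Finset.sum_le_sum fun i (_ : i ∈ Finset.univ) =>
    Finset.sum_le_sum fun j (_ : j ∈ Finset.univ) => h2 i j
  rw [h1] at h3
  have h4 : ∀ (X Y : Finset ι), ∑ i, ∑ j, (if i ∈ X ∧ j ∈ Y then (1 : ℤ) else 0) =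
      X.card * Y.card := by
    intro X Y
    simp [ite_and]
  simp_rw [Finset.sum_add_distrib, h4] at h3
  linarith

theorem AddChar.eq_zero_of_conj_invariant {G : Type*} [Group G] [Finite G] (A : Subgroup G)
    [IsMulCommutative A] (hA : ∀ a ∈ A, a ≠ 1 → ∀ h, h * a = a * h → h ∈ A)
    (ψ : AddChar (Additive A) ℂ) (h : G) (hh : ∀ a ∈ A, h * a * h⁻¹ ∈ A) (hhA : h ∉ A)
    (hψ : ∀ (a : G) (ha : a ∈ A), ψ (.ofMul ⟨h * a * h⁻¹, hh a ha⟩) = ψ (.ofMul ⟨a, ha⟩)) :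
    ψ = 0 := by
  let f : A → A := fun a => ⟨h * a * h⁻¹, hh a a.2⟩ * a⁻¹
  have hf : Function.Injective f := by
    intro a b hab
    have h0 := congrArg Subtype.val hab
    simp only [f, Subgroup.coe_mul, InvMemClass.coe_inv] at h0
    have hc : (b : G)⁻¹ * a = a * (b : G)⁻¹ := by
      have := mul_comm (b⁻¹) a
      exact congrArg Subtype.val this
    have key : h * ((b : G)⁻¹ * a) = ((b : G)⁻¹ * a) * h := by
      have e1 : h * (a : G) * h⁻¹ = h * b * h⁻¹ * ((b : G)⁻¹ * a) := by
        rw [← mul_assoc (h * b * h⁻¹), ← h0]; group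
      have e2 : h * ((b : G)⁻¹ * a) * h⁻¹ = (b : G)⁻¹ * a := by
        calc h * ((b : G)⁻¹ * a) * h⁻¹ = (h * b * h⁻¹)⁻¹ * (h * a * h⁻¹) := by group
          _ = _ := by rw [e1]; group
      calc h * ((b : G)⁻¹ * a) = (h * ((b : G)⁻¹ * a) * h⁻¹) * h := by group
        _ = _ := by rw [e2]
    by_contra hne
    refine hhA (hA ((b : G)⁻¹ * a) (A.mul_mem (A.inv_mem b.2) a.2) (fun h1 => hne ?_) h key)
    exact Subtype.ext (inv_mul_eq_one.mp h1).symm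
  have hs : Function.Surjective f := Finite.surjective_of_injective hf
  ext a
  obtain ⟨b, hb⟩ := hs a.toMul
  have : a = .ofMul (f b) := by rw [hb]; rfl
  rw [this]
  show ψ (.ofMul (⟨h * b * h⁻¹, hh b b.2⟩ * b⁻¹)) = _
  rw [ofMul_mul, AddChar.map_add_eq_mul, hψ b b.2, ofMul_inv, ← AddChar.map_add_eq_mul]
  simp

theorem Matrix.trace_restrict_dichotomy {G n : Type*} [Group G] [Fintype G] [Fintype n]
    [DecidableEq n]
    (ρ : G →* Matrix n n ℂ) (A : Subgroup G) [IsMulCommutative A]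
    (hA : ∀ a ∈ A, a ≠ 1 → ∀ h, h * a = a * h → h ∈ A) (N : Subgroup G)
    (hN : ∀ h ∈ N, ∀ a ∈ A, h * a * h⁻¹ ∈ A) (q : ℕ) (hq : Nat.card N = Nat.card A * q)
    (U : Finset G) (hU : ∀ a, a ∈ U ↔ a ∈ A ∧ a ≠ 1) :
    (∃ c : ℤ, ∀ a ∈ A, a ≠ 1 → (ρ a).trace = c) ∨
      (q : ℝ) * (Nat.card A - q) ≤
        ∑ a ∈ U, ‖(ρ a).trace‖ ^ 2 := by
  classical
  obtain ⟨m, hm, hm'⟩ := Matrix.exists_trace_eq_sum_addChar (ρ.comp A.subtype)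
  have hcard : Fintype.card (AddChar (Additive A) ℂ) = Nat.card A := by
    rw [AddChar.card_eq, ← Nat.card_eq_fintype_card]; rfl
  by_cases hconst : ∃ v, ∀ ψ, ψ ≠ 0 → m ψ = v
  · left
    obtain ⟨v, hv⟩ := hconst
    refine ⟨(m 0 : ℤ) - v, fun a ha ha1 => ?_⟩
    have h1 := hm ⟨a, ha⟩
    have h2 : ∑ ψ : AddChar (Additive A) ℂ, ψ (.ofMul ⟨a, ha⟩) = 0 := by
      rw [AddChar.sum_apply_eq_zero_iff_ne_zero]
      intro h
      exact ha1 (congrArg Subtype.val h)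
    rw [← Finset.add_sum_erase _ _ (Finset.mem_univ 0)] at h1 h2
    have h3 : ∑ ψ ∈ Finset.univ.erase 0, (m ψ : ℂ) * ψ (.ofMul ⟨a, ha⟩) =
        v * ∑ ψ ∈ Finset.univ.erase (0 : AddChar (Additive A) ℂ), ψ (.ofMul ⟨a, ha⟩) := by
      rw [Finset.mul_sum]
      refine Finset.sum_congr rfl fun ψ hψ => ?_
      rw [hv ψ (Finset.ne_of_mem_erase hψ)]
    rw [h3, eq_neg_of_add_eq_zero_right h2] at h1
    change (ρ a).trace = _ at h1
    rw [h1]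
    push_cast
    simp
    ring
  · right
    push Not at hconst
    obtain ⟨ψ₁, hψ₁, -⟩ := hconst (m 0 + 1)
    obtain ⟨ψ₂, hψ₂, h12⟩ := hconst (m ψ₁)
    -- conjugation on characters
    let cj : N → AddChar (Additive A) ℂ → AddChar (Additive A) ℂ := fun h ψ =>
      ψ.compAddMonoidHom (MonoidHom.toAdditive
        { toFun := fun a => ⟨h * a * h⁻¹, hN h h.2 a a.2⟩
          map_one' := by ext; simp
          map_mul' := fun a b => by ext; simp })
    have hcj : ∀ h ψ (a : A), cj h ψ (.ofMul a) = ψ (.ofMul ⟨h * a * h⁻¹, hN h h.2 a a.2⟩) :=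
      fun _ _ _ => rfl
    have hmcj : ∀ h ψ, m (cj h ψ) = m ψ := by
      intro h ψ
      have hc : (Fintype.card A : ℂ) ≠ 0 := by simp
      have : (Fintype.card A : ℂ) * m (cj h ψ) = Fintype.card A * m ψ := by
        rw [← hm', ← hm']
        have hb : Function.Bijective (fun a : A => (⟨h * a * h⁻¹, hN h h.2 a a.2⟩ : A)) := by
          rw [← Finite.injective_iff_bijective]
          intro a b hab
          have := congrArg Subtype.val hab
          ext
          simpa using this
        refine Fintype.sum_equiv (Equiv.ofBijective _ hb) _ _ fun a => ?_
        simp only [Equiv.ofBijective_apply, MonoidHom.comp_apply, Subgroup.coe_subtype,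
          InvMemClass.coe_inv]
        have e1 : (ρ ((h : G) * a * (h : G)⁻¹)).trace = (ρ a).trace := by
          rw [map_mul, Matrix.trace_mul_comm, ← map_mul]; simp
        rw [e1, AddChar.map_neg_eq_conj, AddChar.map_neg_eq_conj, hcj]
        rfl
      exact_mod_cast mul_left_cancel₀ hc this
    have horb : ∀ ψ, ψ ≠ 0 → q ≤ (Finset.univ.image fun h => cj h ψ).card := by
      intro ψ hψ
      have h1 : (Finset.univ : Finset N).card ≤
          Nat.card A * (Finset.univ.image fun h => cj h ψ).card := by
        refine Finset.card_le_mul_card_image _ _ fun b hb => ?_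
        obtain ⟨h₀, -, rfl⟩ := Finset.mem_image.mp hb
        rw [Nat.card_eq_fintype_card, ← Finset.card_univ]
        refine Finset.card_le_card_of_surjOn (f := fun a : A => if h : (a : G) * h₀ ∈ N then
          (⟨a * h₀, h⟩ : N) else 1) ?_
        intro h hh
        simp only [Finset.coe_filter, Finset.mem_univ, true_and, Set.mem_ofPred_eq] at hh
        have hmem : (h : G) * (h₀ : G)⁻¹ ∈ A := by
          by_contra hnot
          refine hψ (AddChar.eq_zero_of_conj_invariant A hA ψ ((h : G) * (h₀ : G)⁻¹)
            (hN _ (N.mul_mem h.2 (N.inv_mem h₀.2))) hnot ?_)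
          intro a ha
          have hmem' := hN _ (N.inv_mem h₀.2) a ha
          have e := congrArg (fun φ : AddChar (Additive A) ℂ => φ (.ofMul ⟨_, hmem'⟩)) hh
          simp only [hcj, InvMemClass.coe_inv] at e
          convert e using 4 <;> group
        refine ⟨⟨_, hmem⟩, by simp, ?_⟩
        simp
      rw [Finset.card_univ, ← Nat.card_eq_fintype_card, hq] at h1
      exact Nat.le_of_mul_le_mul_left h1 Nat.card_pos
    let S : Finset (AddChar (Additive A) ℂ) := Finset.univ.filter fun ψ => m ψ = m ψ₁
    have hS1 : q ≤ S.card := (horb ψ₁ hψ₁).trans (Finset.card_le_card fun φ hφ => by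
      obtain ⟨h, -, rfl⟩ := Finset.mem_image.mp hφ
      simp [S, hmcj])
    have hS2 : q ≤ Sᶜ.card := (horb ψ₂ hψ₂).trans (Finset.card_le_card fun φ hφ => by
      obtain ⟨h, -, rfl⟩ := Finset.mem_image.mp hφ
      simp [S, hmcj, h12])
    have hvar := card_mul_card_compl_le_of_variance (fun ψ => (m ψ : ℤ)) S (m ψ₁)
      (by simp [S])
    have hsum : S.card + Sᶜ.card = Nat.card A := by rw [Finset.card_add_card_compl, hcard]
    rw [hcard] at hvar
    have hnorm : ∑ a : A, ‖(ρ a).trace‖ ^ 2 = Nat.card A * ∑ ψ, (m ψ : ℝ) ^ 2 := by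
      have : ∑ a : A, (ρ a).trace * starRingEnd ℂ (ρ a).trace =
          Nat.card A * ∑ ψ, (m ψ : ℂ) ^ 2 := by
        have h0 : ∀ a : A, (ρ a).trace = ∑ ψ, (m ψ : ℂ) * ψ (.ofMul a) := hm
        have h1 : ∀ a : A, (ρ a).trace * starRingEnd ℂ (ρ a).trace =
            ∑ ψ, (m ψ : ℂ) * ((ρ a).trace * ψ (-.ofMul a)) := by
          intro a
          nth_rw 2 [h0]
          rw [map_sum, Finset.mul_sum]
          refine Finset.sum_congr rfl fun ψ _ => ?_
          rw [AddChar.map_neg_eq_conj, map_mul, map_natCast]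
          ring
        simp_rw [h1]
        rw [Finset.sum_comm, Finset.mul_sum]
        refine Finset.sum_congr rfl fun ψ _ => ?_
        rw [← Finset.mul_sum]
        have := hm' ψ
        simp only [MonoidHom.comp_apply, Subgroup.coe_subtype] at this
        rw [this, Nat.card_eq_fintype_card]
        ring
      simp_rw [Complex.mul_conj, Complex.normSq_eq_norm_sq] at this
      exact_mod_cast this
    have hone : ‖(ρ (1 : G)).trace‖ ^ 2 = (∑ ψ, (m ψ : ℝ)) ^ 2 := by
      have h0 := hm 1
      simp only [ofMul_one, AddChar.map_zero_eq_one, mul_one] at h0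
      have h0' : (ρ (1 : G)).trace = ((∑ ψ, m ψ : ℕ) : ℂ) := by
        push_cast
        exact h0
      rw [h0', Complex.norm_natCast]
      push_cast
      rfl
    have hsplit : ∑ a : A, ‖(ρ a).trace‖ ^ 2 = ‖(ρ (1 : G)).trace‖ ^ 2 +
        ∑ a ∈ U, ‖(ρ a).trace‖ ^ 2 := by
      have h1 : ∑ a : A, ‖(ρ a).trace‖ ^ 2 = ∑ a ∈ insert 1 U, ‖(ρ a).trace‖ ^ 2 := by
        refine (Finset.sum_subtype (p := (· ∈ A)) (insert 1 U) (fun x => ?_)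
          (fun a => ‖(ρ a).trace‖ ^ 2)).symm
        rw [Finset.mem_insert, hU]
        by_cases hx : x = 1
        · simp [hx, A.one_mem]
        · simp [hx]
      rw [h1, Finset.sum_insert (by simp [hU])]
    have hvarR : ((S.card : ℝ) * Sᶜ.card) ≤
        Nat.card A * ∑ ψ, (m ψ : ℝ) ^ 2 - (∑ ψ, (m ψ : ℝ)) ^ 2 := by
      exact_mod_cast hvar
    have hs1 : (q : ℝ) ≤ S.card := by exact_mod_cast hS1
    have hs2 : (q : ℝ) ≤ Sᶜ.card := by exact_mod_cast hS2
    have hs3 : (S.card : ℝ) + Sᶜ.card = Nat.card A := by exact_mod_cast hsum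
    nlinarith [mul_nonneg (sub_nonneg.mpr hs1) (sub_nonneg.mpr hs2)]

end CharacterTable

/-- A group in which centralizers of nontrivial elements are abelian. -/
def CommTransitive (G : Type*) [Group G] : Prop :=
  ∀ x y z : G, x ≠ 1 → Commute x y → Commute x z → Commute y z

namespace CommTransitive

open scoped Classical in
/-- The nontrivial elements with a conjugate commuting with `x`. -/
noncomputable def fam {G : Type*} [Group G] [Fintype G] (x : G) : Finset G :=
  Finset.univ.filter fun y => y ≠ 1 ∧ ∃ h, Commute (h * y * h⁻¹) x

open scoped Classical in
/-- The nontrivial elements commuting with `x`. -/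
noncomputable def punct {G : Type*} [Group G] [Fintype G] (x : G) : Finset G :=
  Finset.univ.filter fun y => y ≠ 1 ∧ Commute y x

variable {G : Type*} [Group G] [Fintype G]

theorem mem_fam {x y : G} : y ∈ fam x ↔ y ≠ 1 ∧ ∃ h, Commute (h * y * h⁻¹) x := by simp [fam]

theorem mem_punct {x y : G} : y ∈ punct x ↔ y ≠ 1 ∧ Commute y x := by simp [punct]

theorem commute_conj_iff {G : Type*} [Group G] (h x y : G) :
    Commute (h * x * h⁻¹) (h * y * h⁻¹) ↔ Commute x y := by
  simp

theorem conj_ne_one {G : Type*} [Group G] {x : G} (hx : x ≠ 1) (h : G) : h * x * h⁻¹ ≠ 1 := by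
  intro e
  exact hx (by simpa using e)

theorem self_mem_fam {x : G} (hx : x ≠ 1) : x ∈ fam x :=
  mem_fam.2 ⟨hx, 1, by simp⟩

theorem punct_subset_fam (x : G) : punct x ⊆ fam x := fun y hy =>
  mem_fam.2 ⟨(mem_punct.1 hy).1, 1, by simpa using (mem_punct.1 hy).2⟩

theorem mem_centralizer {G : Type*} [Group G] {x y : G} :
    y ∈ Subgroup.centralizer {x} ↔ Commute y x := by
  rw [Subgroup.mem_centralizer_singleton_iff]; rfl

variable (hG : CommTransitive G)
include hG

omit [Fintype G] in
theorem commute_iff {x y : G} (hx : x ≠ 1) (hy : y ≠ 1) (hxy : Commute x y) (a : G) :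
    Commute a x ↔ Commute a y :=
  ⟨fun h => hG x a y hx h.symm hxy, fun h => hG y a x hy h.symm hxy.symm⟩

theorem fam_eq {x y : G} (hx : x ≠ 1) (hy : y ∈ fam x) : fam y = fam x := by
  obtain ⟨hy1, k, hk⟩ := mem_fam.1 hy
  ext z
  rw [mem_fam, mem_fam]
  refine and_congr_right fun _ => ⟨?_, ?_⟩
  · rintro ⟨h, hh⟩
    refine ⟨k * h, ?_⟩
    have := (commute_conj_iff k _ _).2 hh
    rw [hG.commute_iff hx (conj_ne_one hy1 k) hk.symm]
    simpa [mul_assoc] using this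
  · rintro ⟨h, hh⟩
    refine ⟨k⁻¹ * h, ?_⟩
    rw [hG.commute_iff hx (conj_ne_one hy1 k) hk.symm] at hh
    have := (commute_conj_iff k⁻¹ _ _).2 hh
    simpa [mul_assoc] using this

theorem conj_mem_fam {x y : G} (hx : x ≠ 1) (hy : y ∈ fam x) (h : G) : h * y * h⁻¹ ∈ fam x := by
  rw [← hG.fam_eq hx hy, mem_fam]
  refine ⟨conj_ne_one (mem_fam.1 hy).1 h, h⁻¹, ?_⟩
  simp [mul_assoc]

theorem inv_mem_fam {x y : G} (hx : x ≠ 1) (hy : y ∈ fam x) : y⁻¹ ∈ fam x := by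
  rw [← hG.fam_eq hx hy, mem_fam]
  exact ⟨by simpa using (mem_fam.1 hy).1, 1, by simp⟩

theorem mem_normalizer {x b k : G} (hx : x ≠ 1) (hb : b ∈ punct x)
    (hk : Commute (k * b * k⁻¹) x) :
    k ∈ Subgroup.normalizer (Subgroup.centralizer {x} : Set G) := by
  obtain ⟨hb1, hbx⟩ := mem_punct.1 hb
  rw [Subgroup.mem_normalizer_iff]
  intro a
  rw [mem_centralizer, mem_centralizer, ← hG.commute_iff hb1 hx hbx,
    ← hG.commute_iff (conj_ne_one hb1 k) hx hk, commute_conj_iff]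

theorem mul_sum_fam {x : G} (hx : x ≠ 1) (f : G → ℝ) (hf : ∀ h y, f (h * y * h⁻¹) = f y) :
    (Nat.card (Subgroup.normalizer (Subgroup.centralizer {x} : Set G)) : ℝ) * ∑ y ∈ fam x, f y =
      Fintype.card G * ∑ a ∈ punct x, f a := by
  classical
  have h1 : ∑ h : G, ∑ a ∈ punct x, f a = Fintype.card G * ∑ a ∈ punct x, f a := by
    rw [Finset.sum_const, nsmul_eq_mul, Finset.card_univ]
  rw [← h1]
  have h2 : ∀ h : G, ∑ a ∈ punct x, f a =
      ∑ y ∈ fam x, if h * y * h⁻¹ ∈ punct x then f y else 0 := by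
    intro h
    rw [← Finset.sum_filter]
    refine Finset.sum_bij' (fun a _ => h⁻¹ * a * h) (fun y _ => h * y * h⁻¹) ?_ ?_ ?_ ?_ ?_
    · intro a ha
      rw [Finset.mem_filter]
      constructor
      · simpa using hG.conj_mem_fam hx (punct_subset_fam x ha) h⁻¹
      · simpa [mul_assoc] using ha
    · intro y hy
      exact (Finset.mem_filter.1 hy).2
    · intro a _; group
    · intro a _; group
    · intro a _
      simpa using (hf h⁻¹ a).symm
  rw [Finset.sum_congr rfl fun h _ => h2 h, Finset.sum_comm, Finset.mul_sum]
  refine Finset.sum_congr rfl fun y hy => ?_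
  rw [← Finset.sum_filter, Finset.sum_const, nsmul_eq_mul]
  congr 2
  obtain ⟨hy1, h₀, hh₀⟩ := mem_fam.1 hy
  rw [Nat.card_eq_fintype_card, ← Finset.card_univ]
  symm
  refine Finset.card_bij' (t := (Finset.univ : Finset (Subgroup.normalizer _)))
    (fun h hh => ⟨h * h₀⁻¹, ?_⟩) (fun k _ => (k : G) * h₀) ?_ ?_ ?_ ?_
  · have hh' := (mem_punct.1 (Finset.mem_filter.1 hh).2).2
    refine hG.mem_normalizer hx (b := h₀ * y * h₀⁻¹) (mem_punct.2 ⟨conj_ne_one hy1 _, hh₀⟩) ?_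
    simpa [mul_assoc] using hh'
  · intro _ _; simp
  · intro k _
    rw [Finset.mem_filter]
    refine ⟨Finset.mem_univ _, mem_punct.2 ⟨conj_ne_one hy1 _, ?_⟩⟩
    have := (Subgroup.mem_normalizer_iff.1 k.2 (h₀ * y * h₀⁻¹)).1 (mem_centralizer.2 hh₀)
    rw [mem_centralizer] at this
    simpa [mul_assoc] using this
  · intro _ _; simp
  · intro _ _; ext; simp

theorem card_centralizer_eq {x y : G} (hx : x ≠ 1) (hy : y ∈ fam x) :
    Nat.card (Subgroup.centralizer {y}) = Nat.card (Subgroup.centralizer {x}) := by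
  obtain ⟨hy1, k, hk⟩ := mem_fam.1 hy
  have : Subgroup.centralizer {x} = (Subgroup.centralizer {y}).map (MulAut.conj k).toMonoidHom := by
    ext a
    rw [mem_centralizer, Subgroup.mem_map_equiv, mem_centralizer,
      hG.commute_iff hx (conj_ne_one hy1 k) hk.symm, ← commute_conj_iff k⁻¹]
    simp [mul_assoc]
  rw [this]
  exact Nat.card_congr ((Subgroup.centralizer {y}).equivMapOfInjective _
    (MulAut.conj k).injective).toEquiv

omit hG in
theorem card_punct (x : G) :
    (punct x).card + 1 = Nat.card (Subgroup.centralizer {x}) := by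
  classical
  have : insert 1 (punct x) = Finset.univ.filter fun a => a ∈ Subgroup.centralizer {x} := by
    ext a
    rw [Finset.mem_insert, mem_punct, Finset.mem_filter, mem_centralizer]
    by_cases ha : a = 1 <;> simp [ha]
  rw [← Finset.card_insert_of_notMem (s := punct x) (a := 1) (by simp [mem_punct]), this,
    Nat.card_eq_fintype_card, Fintype.card_subtype]

omit hG in
theorem card_conj_class [DecidableEq (ConjClasses G)] (y : G) :
    (Finset.univ.filter fun z : G => ConjClasses.mk z = ConjClasses.mk y).card *
      Nat.card (Subgroup.centralizer {y}) = Fintype.card G := by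
  classical
  have h1 := MulAction.card_orbit_mul_card_stabilizer_eq_card_group (ConjAct G) y
  rw [← Nat.card_eq_fintype_card (α := MulAction.stabilizer _ _),
    ← Subgroup.nat_card_centralizer_nat_card_stabilizer] at h1
  rw [← ConjAct.card (G := G), ← h1]
  congr 1
  rw [Fintype.card_subtype]
  congr 1
  ext z
  simp only [Finset.mem_filter, Finset.mem_univ, true_and]
  rw [ConjAct.mem_orbit_conjAct, ConjClasses.mk_eq_mk_iff_isConj]

theorem card_classes {x : G} [DecidableEq (ConjClasses G)] (hx : x ≠ 1) (q : ℕ)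
    (hq : Nat.card (Subgroup.normalizer (Subgroup.centralizer {x} : Set G)) =
      Nat.card (Subgroup.centralizer {x}) * q) :
    ((fam x).image ConjClasses.mk).card * q + 1 = Nat.card (Subgroup.centralizer {x}) := by
  classical
  have h1 := hG.mul_sum_fam hx (fun _ => 1) (fun _ _ => rfl)
  simp only [Finset.sum_const, nsmul_eq_mul, mul_one] at h1
  have h1' : Nat.card (Subgroup.normalizer (Subgroup.centralizer {x} : Set G)) * (fam x).card =
    Fintype.card G * (punct x).card := by exact_mod_cast h1
  have h2 := card_punct x
  have h3 : (fam x).card * Nat.card (Subgroup.centralizer {x}) =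
      ((fam x).image ConjClasses.mk).card * Fintype.card G := by
    rw [Finset.card_eq_sum_card_image ConjClasses.mk (fam x), Finset.sum_mul,
      Finset.card_eq_sum_ones, Finset.sum_mul]
    refine Finset.sum_congr rfl fun c hc => ?_
    obtain ⟨y, hy, rfl⟩ := Finset.mem_image.1 hc
    rw [one_mul, ← card_conj_class y, hG.card_centralizer_eq hx hy]
    congr 2
    ext z
    simp only [Finset.mem_filter, Finset.mem_univ, true_and, and_iff_right_iff_imp]
    intro hz
    obtain ⟨c, hc⟩ := isConj_iff.1 (ConjClasses.mk_eq_mk_iff_isConj.1 hz.symm)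
    rw [← hc]
    exact hG.conj_mem_fam hx hy c
  rw [← h2]
  congr 1
  rw [hq] at h1'
  have hpos : 0 < Fintype.card G := Fintype.card_pos
  apply Nat.eq_of_mul_eq_mul_left hpos
  rw [← h1', ← mul_assoc, mul_comm (Fintype.card G), ← h3]
  ring

end CommTransitive

theorem Finset.even_card_of_involutive {α : Type*} (s : Finset α) (f : α → α)
    (hf : ∀ a ∈ s, f a ∈ s) (hff : ∀ a ∈ s, f (f a) = a) (hne : ∀ a ∈ s, f a ≠ a) :
    Even s.card := by
  have h : ∑ a ∈ s, (1 : ZMod 2) = 0 := by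
    refine Finset.sum_involution (fun a _ => f a) ?_ ?_ ?_ ?_
    · intro _ _; decide
    · intro a ha _; exact hne a ha
    · intro a ha; exact hf a ha
    · intro a ha; exact hff a ha
  rw [Finset.sum_const, nsmul_eq_mul, mul_one] at h
  exact (ZMod.natCast_eq_zero_iff_even).1 h

namespace CharTable

variable {G : Type*} [Group G] [Fintype G] [DecidableEq G] (T : CharTable G)

open scoped Classical in
/-- The characters which are not a constant integer on `t`. -/
noncomputable def nonconst (t : Finset G) : Finset (Fin T.k) :=
  Finset.univ.filter fun i => ¬ ∃ c : ℤ, ∀ y ∈ t, T.χ i y = c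

theorem mem_nonconst {t : Finset G} {i} :
    i ∈ T.nonconst t ↔ ¬ ∃ c : ℤ, ∀ y ∈ t, T.χ i y = c := by simp [nonconst]

theorem notMem_nonconst {t : Finset G} {i} :
    i ∉ T.nonconst t ↔ ∃ c : ℤ, ∀ y ∈ t, T.χ i y = c := by rw [mem_nonconst, not_not]

theorem triv_notMem_nonconst (t : Finset G) : T.triv ∉ T.nonconst t :=
  T.notMem_nonconst.2 ⟨1, fun y _ => by simp [χ_triv]⟩

theorem dual_mem_nonconst {t : Finset G} {i} (hi : i ∈ T.nonconst t) :
    T.dual i ∈ T.nonconst t := by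
  rw [mem_nonconst] at hi ⊢
  rintro ⟨c, hc⟩
  refine hi ⟨c, fun y hy => ?_⟩
  have := hc y hy
  rw [χ_dual, χ_inv] at this
  rw [← Complex.conj_conj (T.χ i y), this, map_intCast]

theorem even_card_nonconst (hodd : Odd (Fintype.card G)) (t : Finset G) :
    Even (T.nonconst t).card :=
  Finset.even_card_of_involutive _ T.dual (fun _ => T.dual_mem_nonconst) (fun i _ => T.dual_dual i)
    fun i hi h => T.triv_notMem_nonconst t ((T.dual_eq_self_iff hodd i).1 h ▸ hi)

theorem mul_inv_eq_norm_sq (i) (x : G) : T.χ i x * T.χ i x⁻¹ = ((‖T.χ i x‖ ^ 2 : ℝ) : ℂ) := by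
  rw [χ_inv, Complex.mul_conj, Complex.normSq_eq_norm_sq]

theorem sum_norm_sq (i) : ∑ x, ‖T.χ i x‖ ^ 2 = Fintype.card G := by
  have h := T.row i i
  simp only [mul_inv_eq_norm_sq, if_pos] at h
  exact_mod_cast h

theorem sum_norm_sq_col (x : G) :
    ∑ i, ‖T.χ i x‖ ^ 2 = Nat.card (Subgroup.centralizer {x}) := by
  have h := T.col' x x
  simp only [mul_inv_eq_norm_sq] at h
  rw [Finset.sum_boole] at h
  have h2 : (Finset.univ.filter fun h => x * h = h * x).card =
      Nat.card (Subgroup.centralizer {x}) := by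
    classical
    rw [Nat.card_eq_fintype_card, Fintype.card_subtype]
    congr 1
    ext h
    simp only [Finset.mem_filter, Finset.mem_univ, true_and]
    rw [CommTransitive.mem_centralizer, commute_iff_eq, eq_comm]
  rw [h2] at h
  exact_mod_cast h

theorem sum_mul_inv_eq_zero {x y : G} (h : ∀ k, k * y * k⁻¹ ≠ x) :
    ∑ i, T.χ i x * T.χ i y⁻¹ = 0 := by
  rw [T.col']
  refine Finset.sum_eq_zero fun k _ => if_neg fun e => h k ?_
  rw [← e]; group

theorem k_le : T.k ≤ Nat.card (ConjClasses G) := by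
  have h1 : ∑ x : G, ∑ i, T.χ i x * T.χ i x⁻¹ = T.k * Fintype.card G := by
    rw [Finset.sum_comm]
    simp [T.row]
  have h2 := card_comm_eq_card_conjClasses_mul_card G
  have h3 : ∑ x : G, ∑ i, T.χ i x * T.χ i x⁻¹ =
      (Nat.card { p : G × G // Commute p.1 p.2 } : ℂ) := by
    classical
    rw [Nat.card_eq_fintype_card, Fintype.card_subtype, ← Finset.sum_boole,
      ← Finset.univ_product_univ, Finset.sum_product]
    simp only [T.col', commute_iff_eq]
  rw [h3, h2, Nat.card_eq_fintype_card (α := G)] at h1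
  have h4 : Nat.card (ConjClasses G) * Fintype.card G = T.k * Fintype.card G := by
    exact_mod_cast h1
  exact (Nat.eq_of_mul_eq_mul_right Fintype.card_pos h4).ge

variable {T}

/-- The values on the classes of `t` of a combination of the characters which are not
constant on `t`, shifted by a constant. -/
noncomputable def combine (T : CharTable G) (t : Finset G) (C : Finset (ConjClasses G)) :
    ((T.nonconst t → ℂ) × ℂ) →ₗ[ℂ] (C → ℂ) where
  toFun v c := ∑ i, v.1 i * T.χ i c.1.out - v.2
  map_add' v w := by
    ext c; simp [add_mul, Finset.sum_add_distrib]; ring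
  map_smul' a v := by
    ext c; simp [mul_sub, Finset.mul_sum, mul_assoc]

theorem χ_out (i) (y : G) : T.χ i (ConjClasses.mk y).out = T.χ i y := by
  have : ConjClasses.mk (ConjClasses.mk y).out = ConjClasses.mk y := Quotient.out_eq _
  obtain ⟨k, hk⟩ := isConj_iff.1 (ConjClasses.mk_eq_mk_iff_isConj.1 this)
  conv_rhs => rw [← hk, χ_conj]

variable (T)

theorem combine_surjective [DecidableEq (ConjClasses G)] (t : Finset G) :
    Function.Surjective (T.combine t (t.image ConjClasses.mk)) := by
  set C := t.image ConjClasses.mk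
  intro f
  let F : G → ℂ := fun y => if h : ConjClasses.mk y ∈ C then f ⟨_, h⟩ else 0
  have hF : ∀ h x, F (h⁻¹ * x * h) = F x := by
    intro h x
    have : ConjClasses.mk (h⁻¹ * x * h) = ConjClasses.mk x := by
      rw [ConjClasses.mk_eq_mk_iff_isConj, isConj_iff]
      exact ⟨h, by group⟩
    simp only [F, this]
  have hE := T.sum_expand F hF
  set a : Fin T.k → ℂ := fun j => ∑ x, F x * T.χ j x⁻¹
  have hc : ∀ j, ∃ c : ℂ, j ∉ T.nonconst t → ∀ y ∈ t, T.χ j y = c := by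
    intro j
    by_cases hj : j ∈ T.nonconst t
    · exact ⟨0, fun h => absurd hj h⟩
    · obtain ⟨c, hc⟩ := T.notMem_nonconst.1 hj
      exact ⟨c, fun _ => hc⟩
  choose c hc using hc
  have hg : (Fintype.card G : ℂ) ≠ 0 := by exact_mod_cast Fintype.card_ne_zero
  refine ⟨(fun i => a i / Fintype.card G,
    - ∑ j ∈ (T.nonconst t)ᶜ, a j * c j / Fintype.card G), ?_⟩
  ext ⟨K, hK⟩
  obtain ⟨y, hy, rfl⟩ := Finset.mem_image.1 hK
  have h1 : F y = f ⟨ConjClasses.mk y, hK⟩ := dif_pos hK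
  have h2 := hE y
  rw [← Finset.sum_add_sum_compl (T.nonconst t), ← Finset.sum_coe_sort,
    Finset.sum_congr (s₁ := (T.nonconst t)ᶜ) rfl fun j hj => by
      rw [hc j (Finset.mem_compl.1 hj) y hy]] at h2
  simp only [combine, LinearMap.coe_mk, AddHom.coe_mk, χ_out, sub_neg_eq_add]
  rw [← h1, ← mul_right_inj' hg, ← h2, mul_add, Finset.mul_sum, Finset.mul_sum]
  congr 1 <;> refine Finset.sum_congr rfl fun j _ => ?_ <;> field_simp <;> exact mul_comm _ _

theorem card_image_mk_le [DecidableEq (ConjClasses G)] (t : Finset G) :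
    (t.image ConjClasses.mk).card ≤ (T.nonconst t).card + 1 := by
  have := LinearMap.finrank_le_finrank_of_surjective (T.combine_surjective t)
  simpa only [Module.finrank_fintype_fun_eq_card, Fintype.card_coe, Module.finrank_prod,
    Module.finrank_self] using this

theorem mul_eq_mul_of_combine_eq_zero [DecidableEq (ConjClasses G)] {t : Finset G}
    (ht : (t.image ConjClasses.mk).card = (T.nonconst t).card)
    {u v : (T.nonconst t → ℂ) × ℂ} (hu : T.combine t (t.image ConjClasses.mk) u = 0)
    (hv : T.combine t (t.image ConjClasses.mk) v = 0) (i j) :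
    u.1 i * v.1 j = u.1 j * v.1 i := by
  have h1 := LinearMap.finrank_range_add_finrank_ker (T.combine t (t.image ConjClasses.mk))
  rw [LinearMap.range_eq_top.2 (T.combine_surjective t), finrank_top] at h1
  simp only [Module.finrank_fintype_fun_eq_card, Fintype.card_coe, Module.finrank_prod,
    Module.finrank_self, ht] at h1
  obtain ⟨⟨w, hw⟩, h⟩ := finrank_le_one_iff.1 (by lia :
    Module.finrank ℂ (LinearMap.ker (T.combine t (t.image ConjClasses.mk))) ≤ 1)
  obtain ⟨a, ha⟩ := h ⟨u, hu⟩
  obtain ⟨b, hb⟩ := h ⟨v, hv⟩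
  have ha' : a • w = u := congrArg Subtype.val ha
  have hb' : b • w = v := congrArg Subtype.val hb
  rw [← ha', ← hb']
  simp only [Prod.smul_fst, Pi.smul_apply, smul_eq_mul]
  ring

theorem combine_eq_zero [DecidableEq (ConjClasses G)] {t : Finset G} {y : G}
    (hy : ∀ x ∈ t, ∀ k, k * y * k⁻¹ ≠ x) :
    ∃ s, T.combine t (t.image ConjClasses.mk) (fun i => T.χ i y⁻¹, s) = 0 := by
  have hc : ∀ j, ∃ c : ℂ, j ∉ T.nonconst t → ∀ y ∈ t, T.χ j y = c := by
    intro j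
    by_cases hj : j ∈ T.nonconst t
    · exact ⟨0, fun h => absurd hj h⟩
    · obtain ⟨c, hc⟩ := T.notMem_nonconst.1 hj
      exact ⟨c, fun _ => hc⟩
  choose c hc using hc
  refine ⟨- ∑ j ∈ (T.nonconst t)ᶜ, c j * T.χ j y⁻¹, ?_⟩
  ext ⟨K, hK⟩
  obtain ⟨x, hx, rfl⟩ := Finset.mem_image.1 hK
  have h2 := T.sum_mul_inv_eq_zero (hy x hx)
  rw [← Finset.sum_add_sum_compl (T.nonconst t), ← Finset.sum_coe_sort,
    Finset.sum_congr (s₁ := (T.nonconst t)ᶜ) rfl fun j hj => by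
      rw [hc j (Finset.mem_compl.1 hj) x hx]] at h2
  simp only [combine, LinearMap.coe_mk, AddHom.coe_mk, χ_out, sub_neg_eq_add, Pi.zero_apply]
  rw [← h2]
  congr 1
  exact Finset.sum_congr rfl fun _ _ => mul_comm _ _

theorem mul_eq_mul_of_card_eq [DecidableEq (ConjClasses G)] {t : Finset G}
    (ht : (t.image ConjClasses.mk).card = (T.nonconst t).card) {y z : G}
    (hy : ∀ x ∈ t, ∀ k, k * y * k⁻¹ ≠ x) (hz : ∀ x ∈ t, ∀ k, k * z * k⁻¹ ≠ x)
    {i j} (hi : i ∈ T.nonconst t) (hj : j ∈ T.nonconst t) :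
    T.χ i y * T.χ j z = T.χ j y * T.χ i z := by
  obtain ⟨s, hs⟩ := T.combine_eq_zero hy
  obtain ⟨r, hr⟩ := T.combine_eq_zero hz
  have h := T.mul_eq_mul_of_combine_eq_zero ht hs hr ⟨i, hi⟩ ⟨j, hj⟩
  simp only [χ_inv] at h
  simpa using congrArg (starRingEnd ℂ) h

end CharTable

namespace CommTransitive

variable {G : Type*} [Group G] [Fintype G] [DecidableEq G] (hG : CommTransitive G)
include hG

omit [Fintype G] [DecidableEq G] in
theorem isMulCommutative_centralizer {x : G} (hx : x ≠ 1) :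
    IsMulCommutative (Subgroup.centralizer {x}) := by
  refine ⟨⟨fun a b => Subtype.ext ?_⟩⟩
  exact hG x a b hx (mem_centralizer.1 a.2).symm (mem_centralizer.1 b.2).symm

omit [DecidableEq G] in
theorem exists_index [DecidableEq (ConjClasses G)] (hodd : Odd (Fintype.card G)) {x : G}
    (hx : x ≠ 1) : ∃ q : ℕ, Nat.card (Subgroup.normalizer (Subgroup.centralizer {x} : Set G)) =
      Nat.card (Subgroup.centralizer {x}) * q ∧ 0 < q ∧
      ((fam x).image ConjClasses.mk).card * q + 1 = Nat.card (Subgroup.centralizer {x}) ∧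
      Even ((fam x).image ConjClasses.mk).card ∧ 2 ≤ ((fam x).image ConjClasses.mk).card := by
  obtain ⟨q, hq⟩ := Subgroup.card_dvd_of_le
    (Subgroup.le_normalizer (H := Subgroup.centralizer {x}))
  have hw := hG.card_classes hx q hq
  rw [← Nat.card_eq_fintype_card] at hodd
  have hN : Odd (Nat.card (Subgroup.centralizer {x}) * q) :=
    hq ▸ hodd.of_dvd_nat (Subgroup.card_subgroup_dvd_card _)
  obtain ⟨hn, hqo⟩ := Nat.odd_mul.1 hN
  have hev : Even ((fam x).image ConjClasses.mk).card := by
    rw [← hw, Nat.odd_add_one, Nat.not_odd_iff_even, Nat.even_mul] at hn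
    exact hn.resolve_right (Nat.not_even_iff_odd.2 hqo)
  have hpos : 0 < ((fam x).image ConjClasses.mk).card :=
    Finset.card_pos.2 ⟨_, Finset.mem_image_of_mem _ (self_mem_fam hx)⟩
  refine ⟨q, hq, hqo.pos, hw, hev, ?_⟩
  obtain ⟨r, hr⟩ := hev
  lia

variable (T : CharTable G)

theorem le_sum_punct {x : G} (hx : x ≠ 1) {q : ℕ}
    (hq : Nat.card (Subgroup.normalizer (Subgroup.centralizer {x} : Set G)) =
      Nat.card (Subgroup.centralizer {x}) * q) {i} (hi : i ∈ T.nonconst (fam x)) :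
    (q : ℝ) * (Nat.card (Subgroup.centralizer {x}) - q) ≤ ∑ a ∈ punct x, ‖T.χ i a‖ ^ 2 := by
  have := hG.isMulCommutative_centralizer hx
  refine (Matrix.trace_restrict_dichotomy (T.rep i) (Subgroup.centralizer {x}) ?_ _ ?_ q hq
    (punct x) ?_).resolve_left ?_
  · intro a ha ha1 h hh
    rw [mem_centralizer] at ha ⊢
    exact (hG.commute_iff ha1 hx ha h).1 hh
  · intro h hh a ha
    exact (Subgroup.mem_normalizer_iff.1 hh a).1 ha
  · intro a
    rw [mem_punct, mem_centralizer, and_comm]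
  · rintro ⟨c, hc⟩
    refine T.mem_nonconst.1 hi ⟨c, fun y hy => ?_⟩
    obtain ⟨hy1, k, hk⟩ := mem_fam.1 hy
    rw [← T.χ_conj i y k]
    exact hc _ (mem_centralizer.2 hk) (conj_ne_one hy1 k)

theorem le_sum_fam {x : G} (hx : x ≠ 1) {q : ℕ} (hq0 : 0 < q)
    (hq : Nat.card (Subgroup.normalizer (Subgroup.centralizer {x} : Set G)) =
      Nat.card (Subgroup.centralizer {x}) * q) {i} (hi : i ∈ T.nonconst (fam x)) :
    (Fintype.card G : ℝ) * (Nat.card (Subgroup.centralizer {x}) - q) ≤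
      Nat.card (Subgroup.centralizer {x}) * ∑ a ∈ fam x, ‖T.χ i a‖ ^ 2 := by
  have h1 := hG.le_sum_punct T hx hq hi
  have h2 := hG.mul_sum_fam hx (fun y => ‖T.χ i y‖ ^ 2) (fun h y => by simp only [T.χ_conj])
  rw [hq] at h2
  push_cast at h2
  have hq' : (0 : ℝ) < q := by exact_mod_cast hq0
  refine le_of_mul_le_mul_left ?_ hq'
  calc _ = (Fintype.card G : ℝ) * (q * (Nat.card (Subgroup.centralizer {x}) - q)) := by ring
    _ ≤ Fintype.card G * ∑ a ∈ punct x, ‖T.χ i a‖ ^ 2 := by gcongr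
    _ = _ := by rw [← h2]; ring

theorem card_lt_two_mul_sum_fam (hodd : Odd (Fintype.card G)) {x : G} (hx : x ≠ 1) {i}
    (hi : i ∈ T.nonconst (fam x)) :
    (Fintype.card G : ℝ) < 2 * ∑ a ∈ fam x, ‖T.χ i a‖ ^ 2 := by
  classical
  obtain ⟨q, hq, hq0, hw, -, hw2⟩ := hG.exists_index hodd hx
  have h := hG.le_sum_fam T hx hq0 hq hi
  have hn : 2 * q + 1 ≤ Nat.card (Subgroup.centralizer {x}) := by
    rw [← hw]; gcongr
  have hn' : 2 * (q : ℝ) + 1 ≤ Nat.card (Subgroup.centralizer {x}) := by exact_mod_cast hn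
  have hg : (0 : ℝ) < Fintype.card G := by exact_mod_cast Fintype.card_pos
  have hq' : (0 : ℝ) < q := by exact_mod_cast hq0
  generalize (Nat.card (Subgroup.centralizer {x}) : ℝ) = n at *
  generalize ∑ a ∈ fam x, ‖T.χ i a‖ ^ 2 = s at *
  have : 0 < n := by linarith
  have h3 : n * Fintype.card G < n * (2 * s) := by nlinarith
  exact lt_of_mul_lt_mul_left h3 this.le

omit [DecidableEq G] in
theorem fam_disjoint {x y : G} (hx : x ≠ 1) (hy : y ≠ 1) (h : fam x ≠ fam y) :
    Disjoint (fam x) (fam y) := by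
  rw [Finset.disjoint_left]
  intro z hzx hzy
  exact h ((hG.fam_eq hx hzx).symm.trans (hG.fam_eq hy hzy))

theorem nonconst_disjoint (hodd : Odd (Fintype.card G)) {x y : G} (hx : x ≠ 1) (hy : y ≠ 1)
    (h : fam x ≠ fam y) : Disjoint (T.nonconst (fam x)) (T.nonconst (fam y)) := by
  rw [Finset.disjoint_left]
  intro i hix hiy
  have h1 := hG.card_lt_two_mul_sum_fam T hodd hx hix
  have h2 := hG.card_lt_two_mul_sum_fam T hodd hy hiy
  have h3 := T.sum_norm_sq i
  have h4 : ∑ a ∈ fam x ∪ fam y, ‖T.χ i a‖ ^ 2 ≤ ∑ a, ‖T.χ i a‖ ^ 2 :=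
    Finset.sum_le_sum_of_subset_of_nonneg (Finset.subset_univ _) fun _ _ _ => by positivity
  rw [Finset.sum_union (hG.fam_disjoint hx hy h)] at h4
  linarith

omit hG in
/-- The set of all families. -/
noncomputable def types (G : Type*) [Group G] [Fintype G] [DecidableEq G] : Finset (Finset G) :=
  (Finset.univ.erase (1 : G)).image fam

omit hG in
theorem mem_types {t : Finset G} : t ∈ types G ↔ ∃ x ≠ 1, fam x = t := by
  simp [types]

theorem card_classes_le (hodd : Odd (Fintype.card G)) [DecidableEq (ConjClasses G)] {x : G}
    (hx : x ≠ 1) : ((fam x).image ConjClasses.mk).card ≤ (T.nonconst (fam x)).card := by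
  obtain ⟨q, -, -, -, ⟨r, hr⟩, -⟩ := hG.exists_index hodd hx
  obtain ⟨s, hs⟩ := T.even_card_nonconst hodd (fam x)
  have := T.card_image_mk_le (fam x)
  lia

theorem card_conjClasses [DecidableEq (ConjClasses G)] :
    Nat.card (ConjClasses G) = ∑ t ∈ types G, (t.image ConjClasses.mk).card + 1 := by
  have h : (Finset.univ : Finset (ConjClasses G)).erase (ConjClasses.mk 1) =
      (types G).biUnion fun t => t.image ConjClasses.mk := by
    ext c
    induction c using Quotient.inductionOn with | _ y
    change ConjClasses.mk y ∈ _ ↔ ConjClasses.mk y ∈ _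
    simp only [Finset.mem_erase, Finset.mem_univ, and_true, Finset.mem_biUnion]
    constructor
    · intro h
      have hy : y ≠ 1 := fun e => h (e ▸ rfl)
      exact ⟨fam y, mem_types.2 ⟨y, hy, rfl⟩, Finset.mem_image_of_mem _ (self_mem_fam hy)⟩
    · rintro ⟨t, ht, h⟩ e
      obtain ⟨x, hx, rfl⟩ := mem_types.1 ht
      obtain ⟨z, hz, hzy⟩ := Finset.mem_image.1 h
      rw [e, ConjClasses.mk_eq_mk_iff_isConj, isConj_one_left] at hzy
      exact (mem_fam.1 hz).1 hzy
  rw [Nat.card_eq_fintype_card, ← Finset.card_univ,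
    ← Finset.card_erase_add_one (Finset.mem_univ (ConjClasses.mk (1 : G))), h,
    Finset.card_biUnion]
  intro t ht s hs hts
  obtain ⟨x, hx, rfl⟩ := mem_types.1 ht
  obtain ⟨y, hy, rfl⟩ := mem_types.1 hs
  rw [Function.onFun, Finset.disjoint_left]
  intro c hc hc'
  obtain ⟨a, ha, rfl⟩ := Finset.mem_image.1 hc
  obtain ⟨b, hb, hab⟩ := Finset.mem_image.1 hc'
  obtain ⟨k, hk⟩ := isConj_iff.1 (ConjClasses.mk_eq_mk_iff_isConj.1 hab)
  exact Finset.disjoint_left.1 (hG.fam_disjoint hx hy hts) ha (hk ▸ hG.conj_mem_fam hy hb k)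

theorem biUnion_nonconst (hodd : Odd (Fintype.card G)) :
    ((types G).biUnion T.nonconst) ⊆ Finset.univ.erase T.triv ∧
    ((types G).biUnion T.nonconst).card = ∑ t ∈ types G, (T.nonconst t).card := by
  constructor
  · intro i hi
    obtain ⟨t, -, hi⟩ := Finset.mem_biUnion.1 hi
    simp only [Finset.mem_erase, Finset.mem_univ, and_true]
    rintro rfl
    exact T.triv_notMem_nonconst t hi
  · rw [Finset.card_biUnion]
    intro t ht s hs hts
    obtain ⟨x, hx, rfl⟩ := mem_types.1 ht
    obtain ⟨y, hy, rfl⟩ := mem_types.1 hs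
    exact hG.nonconst_disjoint T hodd hx hy hts

theorem card_nonconst [DecidableEq (ConjClasses G)] (hodd : Odd (Fintype.card G)) :
    (∀ t ∈ types G, (t.image ConjClasses.mk).card = (T.nonconst t).card) ∧
    (types G).biUnion T.nonconst = Finset.univ.erase T.triv := by
  obtain ⟨h1, h2⟩ := hG.biUnion_nonconst T hodd
  have h3 : ∀ t ∈ types G, (t.image ConjClasses.mk).card ≤ (T.nonconst t).card := by
    intro t ht
    obtain ⟨x, hx, rfl⟩ := mem_types.1 ht
    exact hG.card_classes_le T hodd hx
  have h4 := Finset.card_le_card h1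
  have h5 := T.k_le
  have h7 : T.k = (Finset.univ.erase T.triv).card + 1 := by
    rw [Finset.card_erase_add_one (Finset.mem_univ _)]; simp
  have h8 := Finset.sum_le_sum h3
  rw [hG.card_conjClasses] at h5
  constructor
  · exact (Finset.sum_eq_sum_iff_of_le h3).1 (by lia)
  · exact Finset.eq_of_subset_of_card_le h1 (by lia)

end CommTransitive

namespace CharTable

variable {G : Type*} [Group G] [Fintype G] [DecidableEq G] (T : CharTable G)

theorem χ_eq_one_of_degree_one (hperf : commutator G = ⊤) {i} (hi : T.d i = 1) (x : G) :
    T.χ i x = 1 := by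
  have hsub : Subsingleton (Fin (T.d i)) := by rw [hi]; infer_instance
  have hcomm : ∀ A B : Matrix (Fin (T.d i)) (Fin (T.d i)) ℂ, A * B = B * A := by
    intro A B
    ext a b
    rw [Subsingleton.elim b a, Matrix.mul_apply, Matrix.mul_apply]
    refine Finset.sum_congr rfl fun c _ => ?_
    rw [Subsingleton.elim c a, mul_comm]
  have h : commutator G ≤ (T.rep i).ker := by
    rw [commutator_def, Subgroup.commutator_le]
    intro a _ b _
    rw [MonoidHom.mem_ker, commutatorElement_def, map_mul, map_mul, map_mul, hcomm (T.rep i a),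
      ← map_mul, ← map_mul, ← map_mul]
    simp
  have hx : x ∈ (T.rep i).ker := h (hperf ▸ Subgroup.mem_top x)
  rw [χ, MonoidHom.mem_ker.1 hx, Matrix.trace_one, Fintype.card_fin, hi, Nat.cast_one]

end CharTable

namespace CommTransitive

variable {G : Type*} [Group G] [Fintype G] [DecidableEq G] (hG : CommTransitive G)
  (T : CharTable G)
include hG

theorem sum_eq_sum_types (f : G → ℝ) :
    ∑ x, f x = f 1 + ∑ t ∈ types G, ∑ x ∈ t, f x := by
  rw [← Finset.sum_biUnion]
  · rw [← Finset.add_sum_erase _ _ (Finset.mem_univ (1 : G))]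
    congr 2
    ext x
    simp only [Finset.mem_erase, Finset.mem_univ, and_true, Finset.mem_biUnion]
    constructor
    · intro hx
      exact ⟨fam x, mem_types.2 ⟨x, hx, rfl⟩, self_mem_fam hx⟩
    · rintro ⟨t, ht, hxt⟩
      obtain ⟨y, hy, rfl⟩ := mem_types.1 ht
      exact (mem_fam.1 hxt).1
  · intro t ht s hs hts
    obtain ⟨x, hx, rfl⟩ := mem_types.1 ht
    obtain ⟨y, hy, rfl⟩ := mem_types.1 hs
    exact hG.fam_disjoint hx hy hts

theorem exists_int_of_mem_nonconst (hodd : Odd (Fintype.card G)) {x y : G} (hx : x ≠ 1)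
    (hy : y ≠ 1) (h : fam x ≠ fam y) {i} (hi : i ∈ T.nonconst (fam x)) :
    ∃ c : ℤ, ∀ z ∈ fam y, T.χ i z = c :=
  T.notMem_nonconst.1 fun hmem =>
    Finset.disjoint_left.1 (hG.nonconst_disjoint T hodd hx hy h) hi hmem

/-- If a character which is not constant on the family of `x` vanishes at `y`, outside this
family, then the characters which are not constant on the family of `y` do not vanish at `x`. -/
theorem ne_zero_of_eq_zero (hodd : Odd (Fintype.card G)) {x y : G} (hx : x ≠ 1)
    (hy : y ≠ 1) (h : fam x ≠ fam y) {i j} (hi : i ∈ T.nonconst (fam x))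
    (hj : j ∈ T.nonconst (fam y)) (hiy : T.χ i y = 0) : T.χ j x ≠ 0 := by
  classical
  intro hjx
  obtain ⟨hcard, hun⟩ := hG.card_nonconst T hodd
  have hout : ∀ {x y : G}, x ≠ 1 → y ≠ 1 → fam x ≠ fam y → ∀ a ∈ fam x, ∀ k, k * y * k⁻¹ ≠ a := by
    intro x y hx hy h a ha k e
    refine Finset.disjoint_left.1 (hG.fam_disjoint hx hy h) ha ?_
    rw [← e]
    exact hG.conj_mem_fam hy (self_mem_fam hy) k
  have hone : ∀ {x : G}, x ≠ 1 → ∀ a ∈ fam x, ∀ k, k * 1 * k⁻¹ ≠ a := by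
    intro x hx a ha k e
    rw [mul_one, mul_inv_cancel] at e
    exact (mem_fam.1 ha).1 e.symm
  have key : ∀ {x y : G}, x ≠ 1 → y ≠ 1 → fam x ≠ fam y → ∀ {i j}, i ∈ T.nonconst (fam x) →
      j ∈ T.nonconst (fam x) → T.χ i y = 0 → T.χ j y = 0 := by
    intro x y hx hy h i j hi hj h0
    have := T.mul_eq_mul_of_card_eq (hcard _ (mem_types.2 ⟨x, hx, rfl⟩)) (hout hx hy h) (hone hx)
      hi hj
    rw [h0, zero_mul, eq_comm, mul_eq_zero] at this
    exact this.resolve_right (T.χ_one_ne_zero i)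
  have h_int : ∀ l, ∃ c : ℤ, T.χ l x * T.χ l y⁻¹ = c := by
    intro l
    by_cases hl : l = T.triv
    · exact ⟨1, by simp [hl, CharTable.χ_triv]⟩
    have hl' : l ∈ Finset.univ.erase T.triv := by simp [hl]
    rw [← hun] at hl'
    obtain ⟨t, ht, hlt⟩ := Finset.mem_biUnion.1 hl'
    obtain ⟨z, hz, rfl⟩ := mem_types.1 ht
    by_cases hzx : fam z = fam x
    · refine ⟨0, ?_⟩
      rw [T.χ_inv, key hx hy h hi (hzx ▸ hlt) hiy]; simp
    by_cases hzy : fam z = fam y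
    · refine ⟨0, ?_⟩
      rw [key hy hx h.symm hj (hzy ▸ hlt) hjx]; simp
    obtain ⟨a, ha⟩ := hG.exists_int_of_mem_nonconst T hodd hz hx hzx hlt
    obtain ⟨b, hb⟩ := hG.exists_int_of_mem_nonconst T hodd hz hy hzy hlt
    refine ⟨a * b, ?_⟩
    rw [ha x (self_mem_fam hx), hb y⁻¹ (hG.inv_mem_fam hy (self_mem_fam hy))]
    push_cast; rfl
  choose F hF using h_int
  have h0 := T.sum_mul_inv_eq_zero (hout hx hy h x (self_mem_fam hx))
  rw [Finset.sum_congr rfl fun l _ => hF l] at h0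
  have h1 : ∑ l, F l = 0 := by exact_mod_cast h0
  have hdual : ∀ l, F (T.dual l) = F l := by
    intro l
    have : ((F (T.dual l) : ℤ) : ℂ) = F l := by
      rw [← hF, T.χ_dual, T.χ_dual, inv_inv, T.χ_inv, ← map_intCast (starRingEnd ℂ) (F l), ← hF,
        map_mul, T.χ_inv, Complex.conj_conj]
    exact_mod_cast this
  have h2 : F T.triv = 1 := by
    have := hF T.triv
    rw [T.χ_triv, T.χ_triv, one_mul] at this
    exact_mod_cast this.symm
  rw [← Finset.add_sum_erase _ _ (Finset.mem_univ T.triv), h2] at h1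
  have h3 : ∑ l ∈ Finset.univ.erase T.triv, (F l : ZMod 2) = 0 := by
    refine Finset.sum_involution (fun l _ => T.dual l) ?_ ?_ ?_ ?_
    · intro l _
      rw [hdual]
      exact CharTwo.add_self_eq_zero _
    · intro l hl _ e
      exact (Finset.mem_erase.1 hl).1 ((T.dual_eq_self_iff hodd l).1 e)
    · intro l hl
      refine Finset.mem_erase.2 ⟨fun e => (Finset.mem_erase.1 hl).1 ?_, Finset.mem_univ _⟩
      rw [← T.dual_dual l, e, T.dual_triv]
    · intro l _; exact T.dual_dual l
  have h4 := congrArg (Int.cast : ℤ → ZMod 2) h1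
  push_cast at h4
  rw [h3] at h4
  revert h4
  decide

theorem sum_eq_sum_nonconst (hodd : Odd (Fintype.card G)) (f : Fin T.k → ℝ) :
    ∑ l, f l = f T.triv + ∑ t ∈ types G, ∑ l ∈ T.nonconst t, f l := by
  classical
  rw [← Finset.sum_biUnion]
  · rw [← Finset.add_sum_erase _ _ (Finset.mem_univ T.triv), (hG.card_nonconst T hodd).2]
  · intro t ht s hs hts
    obtain ⟨x, hx, rfl⟩ := mem_types.1 ht
    obtain ⟨y, hy, rfl⟩ := mem_types.1 hs
    exact hG.nonconst_disjoint T hodd hx hy hts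

omit hG in
theorem one_le_norm_sq {c : ℤ} (hc : (c : ℂ) ≠ 0) : 1 ≤ ‖(c : ℂ)‖ ^ 2 := by
  rw [Complex.norm_intCast]
  have : 1 ≤ |c| := Int.one_le_abs (by exact_mod_cast hc)
  have : (1 : ℝ) ≤ |(c : ℝ)| := by exact_mod_cast this
  nlinarith

open scoped Classical in
theorem sum_card_classes_le (hodd : Odd (Fintype.card G)) {x : G} (hx : x ≠ 1) {q : ℕ}
    (hq0 : 0 < q) (hq : Nat.card (Subgroup.normalizer (Subgroup.centralizer {x} : Set G)) =
      Nat.card (Subgroup.centralizer {x}) * q) {i} (hi : i ∈ T.nonconst (fam x)) :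
    1 + ∑ t ∈ ((types G).erase (fam x)).filter (fun t => ∀ y ∈ t, T.χ i y = 0),
      ((t.image ConjClasses.mk).card : ℝ) ≤ q := by
  have hw := hG.card_classes hx q hq
  have hcard := (hG.card_nonconst T hodd).1
  have hx' := mem_types.2 ⟨x, hx, rfl⟩
  have hp := card_punct x
  rw [← hw] at hp
  set w := ((fam x).image ConjClasses.mk).card with hwdef
  have hw0 : 0 < w := Finset.card_pos.2 ⟨_, Finset.mem_image_of_mem _ (self_mem_fam hx)⟩
  have hp' : ((punct x).card : ℝ) = w * q := by exact_mod_cast Nat.succ_injective hp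
  have h1 : ∑ l, ∑ a ∈ punct x, ‖T.χ l a‖ ^ 2 = (w * q) * (w * q + 1) := by
    rw [Finset.sum_comm, Finset.sum_congr rfl fun a ha => by
      rw [T.sum_norm_sq_col, hG.card_centralizer_eq hx (punct_subset_fam x ha), ← hw],
      Finset.sum_const, nsmul_eq_mul, hp']
    push_cast; rfl
  rw [hG.sum_eq_sum_nonconst T hodd, ← Finset.add_sum_erase _ _ hx'] at h1
  have h2 : ∑ a ∈ punct x, ‖T.χ T.triv a‖ ^ 2 = w * q := by
    simp [T.χ_triv, hp']
  have h3 : (w : ℝ) * (q * (w * q + 1 - q)) ≤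
      ∑ l ∈ T.nonconst (fam x), ∑ a ∈ punct x, ‖T.χ l a‖ ^ 2 := by
    have : ∀ l ∈ T.nonconst (fam x), (q * (w * q + 1 - q) : ℝ) ≤
        ∑ a ∈ punct x, ‖T.χ l a‖ ^ 2 := by
      intro l hl
      have := hG.le_sum_punct T hx hq hl
      rw [← hw] at this
      push_cast at this
      exact this
    have := Finset.card_nsmul_le_sum _ _ _ this
    rwa [nsmul_eq_mul, ← hcard _ hx'] at this
  have h4 : ∑ t ∈ ((types G).erase (fam x)).filter (fun t => ∀ y ∈ t, T.χ i y = 0),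
      ((t.image ConjClasses.mk).card : ℝ) * (w * q) ≤
      ∑ t ∈ (types G).erase (fam x), ∑ l ∈ T.nonconst t, ∑ a ∈ punct x, ‖T.χ l a‖ ^ 2 := by
    have hle := Finset.sum_le_sum_of_subset_of_nonneg
      (f := fun t => ∑ l ∈ T.nonconst t, ∑ a ∈ punct x, ‖T.χ l a‖ ^ 2)
      (Finset.filter_subset (fun t => ∀ y ∈ t, T.χ i y = 0) ((types G).erase (fam x)))
      (fun t _ _ => Finset.sum_nonneg fun l _ => Finset.sum_nonneg fun a _ => sq_nonneg _)
    refine le_trans (Finset.sum_le_sum fun t ht => ?_) hle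
    obtain ⟨ht, hti⟩ := Finset.mem_filter.1 ht
    obtain ⟨hne, ht⟩ := Finset.mem_erase.1 ht
    have key : ∀ l ∈ T.nonconst t, (w * q : ℝ) ≤ ∑ a ∈ punct x, ‖T.χ l a‖ ^ 2 := by
      intro l hl
      obtain ⟨y, hy, rfl⟩ := mem_types.1 ht
      obtain ⟨c, hc⟩ := hG.exists_int_of_mem_nonconst T hodd hy hx hne hl
      have hc0 := hG.ne_zero_of_eq_zero T hodd hx hy hne.symm hi hl (hti y (self_mem_fam hy))
      rw [hc x (self_mem_fam hx)] at hc0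
      rw [← hp', Finset.cast_card]
      refine Finset.sum_le_sum fun a ha => ?_
      rw [hc a (punct_subset_fam x ha)]
      exact one_le_norm_sq hc0
    have := Finset.card_nsmul_le_sum _ _ _ key
    rwa [nsmul_eq_mul, ← hcard t ht] at this
  rw [← Finset.sum_mul] at h4
  have hwq : (0 : ℝ) < w * q := by positivity
  generalize ∑ t ∈ ((types G).erase (fam x)).filter (fun t => ∀ y ∈ t, T.χ i y = 0),
      ((t.image ConjClasses.mk).card : ℝ) = S at *
  refine le_of_mul_le_mul_right ?_ hwq
  nlinarith

omit [DecidableEq G] in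
theorem card_mul_card_centralizer [DecidableEq (ConjClasses G)] {x : G} (hx : x ≠ 1) {q : ℕ}
    (hq0 : 0 < q) (hq : Nat.card (Subgroup.normalizer (Subgroup.centralizer {x} : Set G)) =
      Nat.card (Subgroup.centralizer {x}) * q) :
    (fam x).card * Nat.card (Subgroup.centralizer {x}) =
      ((fam x).image ConjClasses.mk).card * Fintype.card G := by
  have h1 := hG.mul_sum_fam hx (fun _ => 1) (fun _ _ => rfl)
  simp only [Finset.sum_const, nsmul_eq_mul, mul_one] at h1
  have h1' : Nat.card (Subgroup.normalizer (Subgroup.centralizer {x} : Set G)) * (fam x).card =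
    Fintype.card G * (punct x).card := by exact_mod_cast h1
  have h2 := hG.card_classes hx q hq
  have h3 : (punct x).card = ((fam x).image ConjClasses.mk).card * q :=
    Nat.succ_injective ((card_punct x).trans h2.symm)
  rw [hq, h3] at h1'
  refine Nat.eq_of_mul_eq_mul_right hq0 ?_
  linarith

omit [DecidableEq G] in
theorem not_odd_card [Nontrivial G] (hperf : commutator G = ⊤) :
    ¬ Odd (Fintype.card G) := by
  classical
  intro hodd
  obtain ⟨T⟩ := CharTable.nonempty G
  obtain ⟨x, hx, hmin⟩ := Finset.exists_min_image (Finset.univ.erase (1 : G))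
    (fun x => Nat.card (Subgroup.centralizer {x}))
    (by obtain ⟨y, hy⟩ := exists_ne (1 : G); exact ⟨y, by simpa using hy⟩)
  replace hx : x ≠ 1 := by simpa using hx
  obtain ⟨q, hq, hq0, hw, -, hw2⟩ := hG.exists_index hodd hx
  have hx' := mem_types.2 ⟨x, hx, rfl⟩
  have hcard := (hG.card_nonconst T hodd).1
  obtain ⟨i, hi⟩ := Finset.card_pos.1 ((by lia : 0 < _).trans_le (hcard _ hx').le)
  have hK := hG.sum_card_classes_le T hodd hx hq0 hq hi
  have hrow := T.sum_norm_sq i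
  have hg := hG.sum_eq_sum_types (fun _ => 1)
  have hfam := hG.le_sum_fam T hx hq0 hq hi
  have hsize : ∀ t ∈ types G, (t.card : ℝ) * Nat.card (Subgroup.centralizer {x}) ≤
      (t.image ConjClasses.mk).card * Fintype.card G := by
    intro t ht
    obtain ⟨y, hy, rfl⟩ := mem_types.1 ht
    obtain ⟨r, hr, hr0, -, -, -⟩ := hG.exists_index hodd hy
    have h1 := hG.card_mul_card_centralizer hy hr0 hr
    have h2 := hmin y (by simpa using hy)
    have h3 := h1 ▸ Nat.mul_le_mul_left (fam y).card h2
    exact_mod_cast h3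
  simp only [Finset.sum_const, nsmul_eq_mul, mul_one, Finset.card_univ] at hg
  rw [hG.sum_eq_sum_types] at hrow
  rw [← Finset.add_sum_erase _ _ hx', ← Finset.sum_filter_add_sum_filter_not
    ((types G).erase (fam x)) (fun t => ∀ y ∈ t, T.χ i y = 0)] at hrow hg
  have hrest : ∑ t ∈ ((types G).erase (fam x)).filter (fun t => ¬ ∀ y ∈ t, T.χ i y = 0),
      (t.card : ℝ) ≤ ∑ t ∈ ((types G).erase (fam x)).filter (fun t => ¬ ∀ y ∈ t, T.χ i y = 0),
        ∑ y ∈ t, ‖T.χ i y‖ ^ 2 := by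
    refine Finset.sum_le_sum fun t ht => ?_
    obtain ⟨ht, hti⟩ := Finset.mem_filter.1 ht
    obtain ⟨hne, ht⟩ := Finset.mem_erase.1 ht
    obtain ⟨y, hy, rfl⟩ := mem_types.1 ht
    obtain ⟨c, hc⟩ := hG.exists_int_of_mem_nonconst T hodd hx hy hne.symm hi
    have hc0 : (c : ℂ) ≠ 0 := fun e => hti fun z hz => (hc z hz).trans e
    rw [Finset.cast_card]
    refine Finset.sum_le_sum fun a ha => ?_
    rw [hc a ha]
    exact one_le_norm_sq hc0
  have hvan : (∑ t ∈ ((types G).erase (fam x)).filter (fun t => ∀ y ∈ t, T.χ i y = 0),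
      (t.card : ℝ)) * Nat.card (Subgroup.centralizer {x}) ≤
      (∑ t ∈ ((types G).erase (fam x)).filter (fun t => ∀ y ∈ t, T.χ i y = 0),
        ((t.image ConjClasses.mk).card : ℝ)) * Fintype.card G := by
    rw [Finset.sum_mul, Finset.sum_mul]
    exact Finset.sum_le_sum fun t ht =>
      hsize t (Finset.mem_of_mem_erase (Finset.mem_filter.1 ht).1)
  have hnn : 0 ≤ ∑ t ∈ ((types G).erase (fam x)).filter (fun t => ∀ y ∈ t, T.χ i y = 0),
        ∑ y ∈ t, ‖T.χ i y‖ ^ 2 := by positivity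
  have hfx := hsize _ hx'
  have hd : ‖T.χ i 1‖ ^ 2 = (T.d i : ℝ) ^ 2 := by rw [T.χ_one]; simp
  rw [hd] at hrow
  rw [← hw] at hfam hvan hfx
  push_cast at hfam hvan hfx
  have hg0 : (0 : ℝ) < Fintype.card G := by exact_mod_cast Fintype.card_pos
  have hw2' : (2 : ℝ) ≤ ((fam x).image ConjClasses.mk).card := by exact_mod_cast hw2
  have hq1 : (1 : ℝ) ≤ q := by exact_mod_cast hq0
  have hd1 : (T.d i : ℝ) ^ 2 ≤ 1 := by
    generalize (((fam x).image ConjClasses.mk).card : ℝ) = w at *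
    generalize (∑ t ∈ ((types G).erase (fam x)).filter (fun t => ∀ y ∈ t, T.χ i y = 0),
        ((t.image ConjClasses.mk).card : ℝ)) = S at *
    generalize (∑ t ∈ ((types G).erase (fam x)).filter (fun t => ∀ y ∈ t, T.χ i y = 0),
      (t.card : ℝ)) = a at *
    generalize (∑ t ∈ ((types G).erase (fam x)).filter (fun t => ¬ ∀ y ∈ t, T.χ i y = 0),
      (t.card : ℝ)) = b at *
    generalize (∑ t ∈ ((types G).erase (fam x)).filter (fun t => ∀ y ∈ t, T.χ i y = 0),
        ∑ y ∈ t, ‖T.χ i y‖ ^ 2) = a' at *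
    generalize (∑ t ∈ ((types G).erase (fam x)).filter (fun t => ¬ ∀ y ∈ t, T.χ i y = 0),
        ∑ y ∈ t, ‖T.χ i y‖ ^ 2) = b' at *
    generalize (∑ y ∈ fam x, ‖T.χ i y‖ ^ 2) = m at *
    generalize (Fintype.card G : ℝ) = g at *
    generalize ((fam x).card : ℝ) = f at *
    generalize (q : ℝ) = r at *
    generalize (T.d i : ℝ) ^ 2 = d at *
    clear * - hK hrow hg hfam hrest hvan hnn hfx hg0 hw2' hq1
    have hn : 0 < w * r + 1 := by nlinarith
    have e1 : (d + b) * (w * r + 1) ≤ g * r := by nlinarith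
    have e2 : a * (w * r + 1) ≤ (r - 1) * g := hvan.trans (by nlinarith)
    have e3 : (w + 2 * r - 1) * g ≤ (w * r + 1) * g := by
      refine mul_le_mul_of_nonneg_right ?_ hg0.le
      nlinarith
    refine le_of_mul_le_mul_right ?_ hn
    have e4 : g * (w * r + 1) = (1 + f + a + b) * (w * r + 1) := by rw [hg]; ring
    nlinarith
  have hd1' : T.d i = 1 := by
    have h1 : T.d i ^ 2 ≤ 1 := by exact_mod_cast hd1
    have h2 := T.d_pos i
    nlinarith
  exact T.mem_nonconst.1 hi ⟨1, fun y _ => by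
    rw [T.χ_eq_one_of_degree_one hperf hd1', Int.cast_one]⟩

end CommTransitive

theorem Subgroup.isMulCommutative_iff_forall {G : Type*} [Group G] {K : Subgroup G} :
    IsMulCommutative K ↔ ∀ a ∈ K, ∀ b ∈ K, a * b = b * a :=
  ⟨fun _ _ ha _ hb => setLike_mul_comm ha hb,
    fun h => ⟨⟨fun a b => Subtype.ext (h a a.2 b b.2)⟩⟩⟩

theorem Subgroup.isMulCommutative_of_le {G : Type*} [Group G] {K H : Subgroup G} (h : K ≤ H)
    (hH : IsMulCommutative H) : IsMulCommutative K :=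
  isMulCommutative_iff_forall.2 fun _ ha _ hb =>
    isMulCommutative_iff_forall.1 hH _ (h ha) _ (h hb)

/-- Burnside's normal complement theorem for simple groups. -/
theorem Sylow.eq_top_of_normalizer_le_centralizer {G : Type*} [Group G] [Finite G]
    [IsSimpleGroup G] {p : ℕ} [Fact p.Prime] (hp : p ∣ Nat.card G) (P : Sylow p G)
    (hP : Subgroup.normalizer (P : Set G) ≤ Subgroup.centralizer (P : Set G)) :
    (P : Subgroup G) = ⊤ := by
  have h := MonoidHom.ker_transferSylow_isComplement' P hP
  rcases (MonoidHom.transferSylow P hP).normal_ker.eq_bot_or_eq_top with hk | hk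
  · rw [hk] at h
    exact Subgroup.isComplement'_bot_left.1 h
  · rw [hk] at h
    exact absurd (Subgroup.isComplement'_top_left.1 h) (P.ne_bot_of_dvd_card hp)

theorem isSolvable_of_quotient {G : Type*} [Group G] (N : Subgroup G) [N.Normal]
    (hN : Group.IsSolvable N) (hQ : Group.IsSolvable (G ⧸ N)) : Group.IsSolvable G :=
  Group.isSolvable_of_ker_le_range N.subtype (QuotientGroup.mk' N) (by simp)

theorem IsMulCommutative.isSolvable {G : Type*} [Group G] (h : IsMulCommutative G) :
    Group.IsSolvable G := Group.isSolvable_of_comm fun a b => h.is_comm.comm a b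

/-- Sylow subgroups of a finite noncommutative simple group are proper. -/
theorem Sylow.ne_top_of_isSimpleGroup {G : Type*} [Group G] [Finite G]
    (hG : ¬ Group.IsSolvable G) {p : ℕ} [Fact p.Prime] (P : Sylow p G) :
    (P : Subgroup G) ≠ ⊤ := by
  intro h
  refine hG ?_
  have : IsPGroup p (⊤ : Subgroup G) := h ▸ P.isPGroup'
  have hp : IsPGroup p G := this.of_equiv Subgroup.topEquiv
  have := hp.isNilpotent
  infer_instance

theorem Sylow.normalizer_ne_top {G : Type*} [Group G] [Finite G] [IsSimpleGroup G]
    (hG : ¬ Group.IsSolvable G) {p : ℕ} [Fact p.Prime] (hp : p ∣ Nat.card G) (P : Sylow p G) :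
    Subgroup.normalizer (P : Set G) ≠ ⊤ := by
  intro h
  have : (P : Subgroup G).Normal := Subgroup.normalizer_eq_top_iff.1 h
  rcases this.eq_bot_or_eq_top with hk | hk
  · exact P.ne_bot_of_dvd_card hp hk
  · exact P.ne_top_of_isSimpleGroup hG hk

theorem isSolvable_of_forall_proper_isMulCommutative (n : ℕ) : ∀ {G : Type*} [Group G] [Finite G],
    Nat.card G = n → (∀ H : Subgroup G, H ≠ ⊤ → IsMulCommutative H) → Group.IsSolvable G := by
  induction n using Nat.strong_induction_on with | _ n ih
  intro G _ _ hn hG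
  by_contra hsol
  have hnt : Nontrivial G := by
    by_contra h
    rw [not_nontrivial_iff_subsingleton] at h
    exact hsol inferInstance
  by_cases hs : IsSimpleGroup G
  · obtain ⟨p, hp, hpd⟩ := Nat.exists_prime_and_dvd (Finite.one_lt_card (α := G)).ne'
    have := Fact.mk hp
    obtain ⟨P⟩ : Nonempty (Sylow p G) := inferInstance
    have h1 := P.normalizer_ne_top hsol hpd
    have h2 := hG _ h1
    refine P.ne_top_of_isSimpleGroup hsol (P.eq_top_of_normalizer_le_centralizer hpd ?_)
    exact (Subgroup.le_centralizer_iff_isMulCommutative.2 h2).trans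
      (Subgroup.centralizer_le (SetLike.coe_subset_coe.2 Subgroup.le_normalizer))
  · obtain ⟨N, hN, hb, ht⟩ : ∃ N : Subgroup G, N.Normal ∧ N ≠ ⊥ ∧ N ≠ ⊤ := by
      by_contra! h
      exact hs ⟨fun N hN => or_iff_not_imp_left.2 (h N hN)⟩
    refine hsol (isSolvable_of_quotient N (hG N ht).isSolvable (ih (Nat.card (G ⧸ N)) ?_ rfl ?_))
    · have h1 := Subgroup.card_eq_card_quotient_mul_card_subgroup N
      have h2 := Subgroup.one_lt_card_iff_ne_bot N |>.2 hb
      have h3 : 0 < Nat.card (G ⧸ N) := Nat.card_pos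
      rw [← hn, h1]
      nlinarith
    · intro H hH
      have h1 : H.comap (QuotientGroup.mk' N) ≠ ⊤ := by
        intro h
        refine hH (Subgroup.comap_injective (QuotientGroup.mk'_surjective N) ?_)
        rw [h, Subgroup.comap_top]
      have := hG _ h1
      rw [← Subgroup.map_comap_eq_self_of_surjective (QuotientGroup.mk'_surjective N) H]
      infer_instance

open scoped IsMulCommutative in
/-- The transfer into a commutative subgroup is a power map on the centre. -/
theorem Subgroup.exists_transfer_eq_pow_index {G : Type*} [Group G] (V : Subgroup G)
    [V.FiniteIndex] (hV : IsMulCommutative V) :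
    ∃ τ : G →* V, ∀ z ∈ Subgroup.center G, (τ z : G) = z ^ V.index := by
  refine ⟨MonoidHom.transfer (MonoidHom.id V), fun z hz => ?_⟩
  have hz' : ∀ g, g * z = z * g := Subgroup.mem_center_iff.1 hz
  rw [MonoidHom.transfer_eq_pow]
  · rfl
  · intro k g _
    have : Commute g (z ^ k) := Commute.pow_right (hz' g) k
    rw [mul_assoc, ← this.eq, inv_mul_cancel_left]

section MinimalNoncommutative

variable {H : Type*} [Group H] [Finite H] {p : ℕ} [hp : Fact p.Prime]

/-- If the elements of order prime to `p` commute with each other, they form a subgroup. -/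
def Subgroup.coprimePart (p : ℕ) (L : Subgroup H) (hL : IsMulCommutative L)
    (h : ∀ x : H, (orderOf x).Coprime p → x ∈ L) : Subgroup H where
  carrier := {x | (orderOf x).Coprime p}
  one_mem' := by simp
  mul_mem' := by
    intro a b ha hb
    have := Subgroup.isMulCommutative_iff_forall.1 hL a (h a ha) b (h b hb)
    exact Nat.Coprime.coprime_dvd_left (Commute.orderOf_mul_dvd_mul_orderOf this)
      (Nat.Coprime.mul_left ha hb)
  inv_mem' := by
    intro a ha
    simpa using ha

/-- Sylow `p`-subgroups of a minimal noncommutative group with a central element of order `p`. -/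
theorem Sylow.cyclic_and_central_in_normalizer
    (hH : ∀ K : Subgroup H, K ≠ ⊤ → IsMulCommutative K)
    (hnc : ∃ a b : H, a * b ≠ b * a) (hnp : ¬ IsPGroup p H) {z : H}
    (hz : z ∈ Subgroup.center H) (hzp : orderOf z = p) (Q : Sylow p H) :
    (∃ y, (Q : Subgroup H) = Subgroup.zpowers y) ∧ z ∈ Q ∧
      ∀ h ∈ Subgroup.normalizer (Q : Set H), ∀ a ∈ Q, h * a = a * h := by
  have hQt : (Q : Subgroup H) ≠ ⊤ := by
    intro h
    have : IsPGroup p (⊤ : Subgroup H) := h ▸ Q.isPGroup'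
    exact hnp (this.of_equiv Subgroup.topEquiv)
  have hQc := hH _ hQt
  obtain ⟨τ, hτ⟩ := Subgroup.exists_transfer_eq_pow_index (Q : Subgroup H) hQc
  have hLt : τ.ker ≠ ⊤ := by
    intro h
    have h1 : τ z = 1 := by
      rw [← MonoidHom.mem_ker, h]; trivial
    have h2 := hτ z hz
    rw [h1] at h2
    have h3 := orderOf_dvd_of_pow_eq_one h2.symm
    rw [hzp] at h3
    exact Q.not_dvd_index h3
  have hLc := hH _ hLt
  have hRL : ∀ x : H, (orderOf x).Coprime p → x ∈ τ.ker := by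
    intro x hx
    rw [MonoidHom.mem_ker, ← orderOf_eq_one_iff]
    obtain ⟨k, hk⟩ := IsPGroup.iff_orderOf.1 Q.isPGroup' (τ x)
    have h1 := orderOf_map_dvd τ x
    rw [hk] at h1 ⊢
    exact (Nat.Coprime.pow_right k hx).symm.eq_one_of_dvd h1
  set R := Subgroup.coprimePart p τ.ker hLc hRL with hR
  have memR : ∀ x, x ∈ R ↔ (orderOf x).Coprime p := fun x => Iff.rfl
  have hRn : R.Normal := ⟨fun x hx g => by
    rw [memR] at hx ⊢
    have := MulEquiv.orderOf_eq (MulAut.conj g) x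
    rw [MulAut.conj_apply] at this
    rwa [this]⟩
  have hRc : IsMulCommutative R := Subgroup.isMulCommutative_of_le (fun x hx => hRL x hx) hLc
  have hQR : ∀ x, x ∈ Q → x ∈ R → x = 1 := by
    intro x hxQ hxR
    rw [memR] at hxR
    obtain ⟨k, hk⟩ := IsPGroup.iff_orderOf.1 Q.isPGroup' ⟨x, hxQ⟩
    rw [Subgroup.orderOf_mk] at hk
    rw [← orderOf_eq_one_iff]
    rw [hk] at hxR ⊢
    exact Nat.Coprime.eq_one_of_dvd (Nat.Coprime.pow_right k hxR) dvd_rfl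
  have hquot : IsPGroup p (H ⧸ R) := by
    intro x
    induction x using QuotientGroup.induction_on with | _ x
    refine ⟨(orderOf x).factorization p, ?_⟩
    rw [← QuotientGroup.mk_pow, QuotientGroup.eq_one_iff, memR,
      orderOf_pow_of_dvd (pow_ne_zero _ hp.out.ne_zero) (Nat.ordProj_dvd _ _)]
    exact (Nat.coprime_ordCompl hp.out (orderOf_pos x).ne').symm
  have hsup : R ⊔ (Q : Subgroup H) = ⊤ := by
    rw [← Subgroup.index_eq_one]
    obtain ⟨k, hk⟩ := IsPGroup.iff_card.1 hquot
    have h1 : (R ⊔ (Q : Subgroup H)).index ∣ p ^ k := by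
      rw [← hk]
      exact Subgroup.index_dvd_of_le le_sup_left
    have h2 : (R ⊔ (Q : Subgroup H)).index ∣ (Q : Subgroup H).index :=
      Subgroup.index_dvd_of_le le_sup_right
    have h3 : (p ^ k).Coprime (Q : Subgroup H).index :=
      Nat.Coprime.pow_left k ((Nat.Prime.coprime_iff_not_dvd hp.out).2 Q.not_dvd_index)
    exact Nat.eq_one_of_dvd_coprimes h3 h1 h2
  have hdec : ∀ h : H, ∃ r ∈ R, ∃ a ∈ Q, r * a = h := by
    intro h
    exact Subgroup.mem_sup_of_normal_left.1 (hsup ▸ Subgroup.mem_top h)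
  have hRcomm := Subgroup.isMulCommutative_iff_forall.1 hRc
  have hQcomm := Subgroup.isMulCommutative_iff_forall.1 hQc
  obtain ⟨y, hy, r, hr, hyr⟩ : ∃ y ∈ Q, ∃ r ∈ R, y * r ≠ r * y := by
    by_contra! hc
    obtain ⟨a, b, hab⟩ := hnc
    obtain ⟨r, hr, y, hy, rfl⟩ := hdec a
    obtain ⟨s, hs, x, hx, rfl⟩ := hdec b
    have e1 := hc y hy s hs
    have e2 := hc x hx r hr
    have e3 := hRcomm r hr s hs
    have e4 := hQcomm y hy x hx
    apply hab
    calc r * y * (s * x) = r * (y * s) * x := by group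
      _ = (r * s) * (y * x) := by rw [e1]; group
      _ = s * (r * x) * y := by rw [e3, e4]; group
      _ = s * x * (r * y) := by rw [← e2]; group
  have hcyc : R ⊔ Subgroup.zpowers y = ⊤ := by
    by_contra hne
    exact hyr (Subgroup.isMulCommutative_iff_forall.1 (hH _ hne) y
      (Subgroup.mem_sup_right (Subgroup.mem_zpowers y)) r (Subgroup.mem_sup_left hr))
  refine ⟨⟨y, le_antisymm ?_ (Subgroup.zpowers_le.2 hy)⟩, ?_, ?_⟩
  · intro a ha
    obtain ⟨s, hs, b, hb, rfl⟩ := Subgroup.mem_sup_of_normal_left.1 (hcyc ▸ Subgroup.mem_top a)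
    have hbQ : b ∈ Q := (Subgroup.zpowers_le.2 hy) hb
    have hsQ : s ∈ (Q : Subgroup H) := by simpa using mul_mem ha (inv_mem hbQ)
    rw [hQR s hsQ hs, one_mul]
    exact hb
  · have hn : (Subgroup.zpowers z).Normal := by
      refine ⟨fun x hx g => ?_⟩
      obtain ⟨k, rfl⟩ := Subgroup.mem_zpowers_iff.1 hx
      have : Commute g (z ^ k) := Commute.zpow_right (Subgroup.mem_center_iff.1 hz g) k
      rw [this.eq, mul_inv_cancel_right]
      exact hx
    have hpz : IsPGroup p (Subgroup.zpowers z) := by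
      rw [IsPGroup.iff_card]
      exact ⟨1, by rw [Nat.card_zpowers, hzp, pow_one]⟩
    exact hpz.le_sylow_of_normal Q (Subgroup.mem_zpowers z)
  · intro h hh a ha
    obtain ⟨ρ, hρ, x, hx, rfl⟩ := hdec h
    have hρN : ρ ∈ Subgroup.normalizer (Q : Set H) := by
      simpa using mul_mem hh (inv_mem (Subgroup.le_normalizer (H := (Q : Subgroup H)) hx))
    have h1 : ρ * a * ρ⁻¹ ∈ Q := (Subgroup.mem_normalizer_iff.1 hρN a).1 ha
    have h2 : ρ * a * ρ⁻¹ * a⁻¹ = 1 := by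
      refine hQR _ (Q.mul_mem h1 (Q.inv_mem ha)) ?_
      have := R.mul_mem hρ (hRn.conj_mem _ (R.inv_mem hρ) a)
      simpa [mul_assoc] using this
    have h3 : ρ * a = a * ρ := by
      rw [mul_inv_eq_one, mul_inv_eq_iff_eq_mul] at h2
      exact h2
    calc ρ * x * a = ρ * (x * a) := by group
      _ = (ρ * a) * x := by rw [hQcomm x hx a ha]; group
      _ = a * (ρ * x) := by rw [h3]; group

end MinimalNoncommutative

theorem IsCyclic.mem_zpowers_of_pow_orderOf_eq_one {C : Type*} [Group C] [Finite C] [IsCyclic C]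
    {u z : C} (h : z ^ orderOf u = 1) : z ∈ Subgroup.zpowers u := by
  classical
  have := Fintype.ofFinite C
  have h1 := IsCyclic.card_pow_eq_one_le (α := C) (orderOf_pos u)
  have h2 : (Subgroup.zpowers u : Set C).toFinset ⊆
      Finset.univ.filter fun a : C => a ^ orderOf u = 1 := by
    intro a ha
    obtain ⟨k, rfl⟩ := Subgroup.mem_zpowers_iff.1 (by simpa using ha)
    rw [Finset.mem_filter]
    refine ⟨Finset.mem_univ _, ?_⟩
    rw [← zpow_natCast, ← zpow_mul, mul_comm, zpow_mul, zpow_natCast, pow_orderOf_eq_one, one_zpow]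
  have h3 : (Subgroup.zpowers u : Set C).toFinset.card = orderOf u := by
    rw [Set.toFinset_card]
    exact Fintype.card_zpowers
  have h4 := Finset.eq_of_subset_of_card_le h2 (by rw [h3]; exact h1)
  have : z ∈ (Subgroup.zpowers u : Set C).toFinset := by
    rw [h4]; simpa using h
  simpa using this

theorem mem_zpowers_of_mem_zpowers {G : Type*} [Group G] [Finite G] {y u z : G}
    (hu : u ∈ Subgroup.zpowers y) (hz : z ∈ Subgroup.zpowers y) (h : z ^ orderOf u = 1) :
    z ∈ Subgroup.zpowers u := by
  have : (⟨z, hz⟩ : Subgroup.zpowers y) ∈ Subgroup.zpowers (⟨u, hu⟩ : Subgroup.zpowers y) :=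
    IsCyclic.mem_zpowers_of_pow_orderOf_eq_one (Subtype.ext (by simpa using h))
  obtain ⟨k, hk⟩ := Subgroup.mem_zpowers_iff.1 this
  exact Subgroup.mem_zpowers_iff.2 ⟨k, by simpa using congrArg Subtype.val hk⟩

theorem Commute.of_mem_zpowers {G : Type*} [Group G] {a u z : G} (h : Commute a u)
    (hz : z ∈ Subgroup.zpowers u) : Commute a z := by
  obtain ⟨k, rfl⟩ := Subgroup.mem_zpowers_iff.1 hz
  exact h.zpow_right k

/-- Noncommutative proper subgroups are maximal. -/
def NoncommutativeSubgroupsMaximal (G : Type*) [Group G] : Prop :=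
  ∀ K H : Subgroup G, K ≤ H → H ≠ ⊤ → ¬ IsMulCommutative K → K = H

section Simple

variable {G : Type*} [Group G] [Finite G] [IsSimpleGroup G]

omit [Finite G] in
theorem centralizer_ne_top_of_simple (hG : ¬ Group.IsSolvable G) {x : G} (hx : x ≠ 1) :
    Subgroup.centralizer {x} ≠ ⊤ := by
  intro h
  have hxc : x ∈ Subgroup.center G := by
    rw [Subgroup.mem_center_iff]
    intro g
    have : g ∈ Subgroup.centralizer {x} := h ▸ Subgroup.mem_top g
    exact CommTransitive.mem_centralizer.1 this
  rcases (inferInstance : (Subgroup.center G).Normal).eq_bot_or_eq_top with hk | hk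
  · rw [hk] at hxc
    exact hx hxc
  · refine hG (Group.isSolvable_of_comm fun a b => ?_)
    exact Subgroup.mem_center_iff.1 (hk ▸ Subgroup.mem_top b) a

omit [Finite G] in
theorem normalizer_ne_top_of_simple {K : Subgroup G} (h1 : K ≠ ⊥) (h2 : K ≠ ⊤) :
    Subgroup.normalizer (K : Set G) ≠ ⊤ := by
  intro h
  rcases (Subgroup.normalizer_eq_top_iff.1 h).eq_bot_or_eq_top with hk | hk
  · exact h1 hk
  · exact h2 hk

namespace NoncommutativeSubgroupsMaximal

variable (hM : NoncommutativeSubgroupsMaximal G)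
include hM

omit [Finite G] in
theorem normalizer_eq {K : Subgroup G} (hK : ¬ IsMulCommutative K) (h2 : K ≠ ⊤) :
    Subgroup.normalizer (K : Set G) = K := by
  refine (hM _ _ Subgroup.le_normalizer (normalizer_ne_top_of_simple ?_ h2) hK).symm
  rintro rfl
  exact hK inferInstance

omit [Finite G] [IsSimpleGroup G] in
theorem isMulCommutative_of_ne_top {H : Subgroup G} (hH : H ≠ ⊤) (K : Subgroup H) (hK : K ≠ ⊤) :
    IsMulCommutative K := by
  by_contra h
  have h1 : ¬ IsMulCommutative (K.map H.subtype) := by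
    rw [Subgroup.isMulCommutative_iff_forall]
    rw [Subgroup.isMulCommutative_iff_forall] at h
    intro hc
    refine h fun a ha b hb => Subtype.ext ?_
    exact hc _ (Subgroup.mem_map_of_mem _ ha) _ (Subgroup.mem_map_of_mem _ hb)
  have h2 := hM _ _ (Subgroup.map_subtype_le K) hH h1
  refine hK (Subgroup.map_injective H.subtype_injective ?_)
  rw [h2, ← MonoidHom.range_eq_map, Subgroup.range_subtype]

theorem isPGroup_centralizer_of_orderOf (hG : ¬ Group.IsSolvable G) {p : ℕ} [hp : Fact p.Prime]
    {z : G} (hz : orderOf z = p) (hc : ¬ IsMulCommutative (Subgroup.centralizer {z})) :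
    IsPGroup p (Subgroup.centralizer {z}) := by
  by_contra hnp
  set H := Subgroup.centralizer {z} with hH
  have memH : ∀ a, a ∈ H ↔ Commute a z := fun a => CommTransitive.mem_centralizer
  have hz1 : z ≠ 1 := by
    rintro rfl
    exact hp.out.one_lt.ne (by simpa using hz)
  have hHt : H ≠ ⊤ := centralizer_ne_top_of_simple hG hz1
  have hzH : z ∈ H := (memH z).2 (Commute.refl z)
  obtain ⟨Q⟩ : Nonempty (Sylow p H) := inferInstance
  have hnc : ∃ a b : H, a * b ≠ b * a := by
    by_contra! h
    exact hc ⟨⟨h⟩⟩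
  have hzc : (⟨z, hzH⟩ : H) ∈ Subgroup.center H := by
    rw [Subgroup.mem_center_iff]
    exact fun g => Subtype.ext ((memH g).1 g.2)
  obtain ⟨⟨y, hy⟩, hzQ, hN⟩ := Sylow.cyclic_and_central_in_normalizer
    (hM.isMulCommutative_of_ne_top hHt) hnc hnp hzc (by rw [Subgroup.orderOf_mk, hz]) Q
  obtain ⟨S, hS⟩ := (Q.isPGroup'.map H.subtype).exists_le_sylow
  have hQS : ∀ a : H, a ∈ Q → (a : G) ∈ S := fun a ha => hS (Subgroup.mem_map_of_mem _ ha)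
  have hSH : ∀ a : H, (a : G) ∈ S → a ∈ Q := by
    have h1 : (S : Subgroup G).subgroupOf H = Q := by
      refine Q.is_maximal' (S.isPGroup'.comap_of_injective _ H.subtype_injective) ?_
      exact fun a ha => hQS a ha
    intro a ha
    change a ∈ (Q : Subgroup H)
    rw [← h1]
    exact ha
  have hSz : z ∈ S := hQS _ hzQ
  have hgen : ∀ u : G, u ∈ S → Commute u z → orderOf u = p →
      z ∈ Subgroup.zpowers u ∧ u ∈ Subgroup.zpowers z := by
    intro u hu huz hup
    have huQ := hSH ⟨u, (memH u).2 huz⟩ hu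
    have e1 : u ∈ Subgroup.zpowers (y : G) := by
      have : (⟨u, (memH u).2 huz⟩ : H) ∈ (Q : Subgroup H) := huQ
      rw [hy] at this
      simpa using Subgroup.mem_map_of_mem H.subtype this
    have e2 : z ∈ Subgroup.zpowers (y : G) := by
      have : (⟨z, hzH⟩ : H) ∈ (Q : Subgroup H) := hzQ
      rw [hy] at this
      simpa using Subgroup.mem_map_of_mem H.subtype this
    exact ⟨mem_zpowers_of_mem_zpowers e1 e2 (by rw [hup, ← hz, pow_orderOf_eq_one]),
      mem_zpowers_of_mem_zpowers e2 e1 (by rw [hz, ← hup, pow_orderOf_eq_one])⟩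
  have hSnt : Nontrivial S := ⟨⟨⟨z, hSz⟩, 1, fun h => hz1 (congrArg Subtype.val h)⟩⟩
  have hcnt : Nontrivial (Subgroup.center S) := S.isPGroup'.center_nontrivial
  have hpd : p ∣ Nat.card (Subgroup.center S) := by
    obtain ⟨n, hn, hn'⟩ := (IsPGroup.nontrivial_iff_card
      (S.isPGroup'.to_subgroup (Subgroup.center S))).1 hcnt
    rw [hn']
    exact dvd_pow_self _ hn.ne'
  obtain ⟨u, hu⟩ := exists_prime_orderOf_dvd_card' p hpd
  have hucomm : ∀ s : G, s ∈ S → Commute s (u : S) := fun s hs =>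
    congrArg Subtype.val (Subgroup.mem_center_iff.1 u.2 ⟨s, hs⟩)
  have hup : orderOf ((u : S) : G) = p := by
    rw [Subgroup.orderOf_coe, Subgroup.orderOf_coe, hu]
  obtain ⟨hzu, -⟩ := hgen (u : S) (u : S).2 (hucomm z hSz).symm hup
  have hSle : ∀ s : G, s ∈ S → s ∈ H := fun s hs => (memH s).2 ((hucomm s hs).of_mem_zpowers hzu)
  have hHN := hM.normalizer_eq hc hHt
  have hpG : p ∣ Nat.card G := by
    rw [← hz]; exact orderOf_dvd_natCard z
  refine S.ne_top_of_isSimpleGroup hG (S.eq_top_of_normalizer_le_centralizer hpG ?_)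
  intro g hg
  have hgH : g ∈ H := by
    rw [← hHN, Subgroup.mem_normalizer_iff]
    have h1 : g⁻¹ * z * g ∈ S := by
      have := (Subgroup.mem_normalizer_iff.1 (inv_mem hg) z).1 hSz
      rwa [inv_inv] at this
    have h2 : orderOf (g⁻¹ * z * g) = p := by
      have := MulEquiv.orderOf_eq (MulAut.conj g⁻¹) z
      rw [MulAut.conj_apply, inv_inv] at this
      rw [this, hz]
    obtain ⟨h3, h4⟩ := hgen _ h1 ((memH _).1 (hSle _ h1)) h2
    intro h
    rw [memH, memH]
    have h5 : Commute (g * h * g⁻¹) z ↔ Commute h (g⁻¹ * z * g) := by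
      have := CommTransitive.commute_conj_iff g h (g⁻¹ * z * g)
      rw [← this]
      simp [mul_assoc]
    rw [h5]
    exact ⟨fun k => k.of_mem_zpowers h4, fun k => k.of_mem_zpowers h3⟩
  rw [Subgroup.mem_centralizer_iff]
  intro s hs
  have hgN : (⟨g, hgH⟩ : H) ∈ Subgroup.normalizer (Q : Set H) := by
    refine Subgroup.mem_normalizer_iff.2 ?_
    intro a
    have := Subgroup.mem_normalizer_iff.1 hg a
    constructor
    · intro ha
      exact hSH _ (this.1 (hQS a ha))
    · intro ha
      exact hSH _ (this.2 (hQS _ ha))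
  have := hN _ hgN ⟨s, hSle s hs⟩ (hSH _ hs)
  exact (congrArg Subtype.val this).symm

end NoncommutativeSubgroupsMaximal

end Simple

theorem IsPGroup.exists_mem_normalizer {G : Type*} [Group G] [Finite G] {p : ℕ} [Fact p.Prime]
    {P M : Subgroup G} (hP : IsPGroup p P) (hM : M < P) :
    ∃ g ∈ P, g ∉ M ∧ g ∈ Subgroup.normalizer (M : Set G) := by
  have := hP.isNilpotent
  have h1 : M.subgroupOf P < ⊤ := by
    rw [lt_top_iff_ne_top, Ne, Subgroup.subgroupOf_eq_top]
    exact hM.not_ge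
  obtain ⟨g, hg, hgM⟩ := SetLike.exists_of_lt
    (Group.normalizerCondition_of_isNilpotent (M.subgroupOf P) h1)
  refine ⟨g, g.2, fun h => hgM (Subgroup.mem_subgroupOf.2 h), ?_⟩
  rw [Subgroup.mem_normalizer_iff''] at hg ⊢
  intro h
  by_cases hh : h ∈ P
  · simpa [Subgroup.mem_subgroupOf] using hg ⟨h, hh⟩
  · refine ⟨fun k => absurd (hM.le k) hh, fun k => absurd ?_ hh⟩
    have := P.mul_mem (P.mul_mem g.2 (hM.le k)) (P.inv_mem g.2)
    simpa [mul_assoc] using this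

theorem IsPGroup.exists_central_ne_one {G : Type*} [Group G] [Finite G] {p : ℕ} [Fact p.Prime]
    {S : Subgroup G} (hS : IsPGroup p S) (h : S ≠ ⊥) :
    ∃ z ∈ S, z ≠ 1 ∧ ∀ s ∈ S, Commute s z := by
  have : Nontrivial S := (Subgroup.nontrivial_iff_ne_bot S).2 h
  have := hS.center_nontrivial
  obtain ⟨z, hz⟩ := exists_ne (1 : Subgroup.center S)
  refine ⟨(z : S), (z : S).2, fun e => hz (Subtype.ext (Subtype.ext e)), fun s hs => ?_⟩
  exact congrArg Subtype.val (Subgroup.mem_center_iff.1 z.2 ⟨s, hs⟩)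

namespace NoncommutativeSubgroupsMaximal

variable {G : Type*} [Group G] [Finite G] [IsSimpleGroup G] (hM : NoncommutativeSubgroupsMaximal G)
  (hG : ¬ Group.IsSolvable G)
include hM hG

theorem exists_sylow_eq_centralizer {x : G} (hx : x ≠ 1)
    (hc : ¬ IsMulCommutative (Subgroup.centralizer {x})) :
    ∃ (p : ℕ) (_ : Fact p.Prime) (S : Sylow p G), Subgroup.centralizer {x} = S := by
  obtain ⟨p, hp, hpd⟩ := Nat.exists_prime_and_dvd (mt orderOf_eq_one_iff.1 hx)
  have := Fact.mk hp
  have hz : orderOf (x ^ (orderOf x / p)) = p := by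
    rw [orderOf_pow_of_dvd (Nat.div_pos (Nat.le_of_dvd (orderOf_pos x) hpd) hp.pos).ne'
      (Nat.div_dvd_of_dvd hpd), Nat.div_div_self hpd (orderOf_pos x).ne']
  set z := x ^ (orderOf x / p)
  have hz1 : z ≠ 1 := by
    rintro h
    rw [h, orderOf_one] at hz
    exact hp.one_lt.ne hz
  have hle : Subgroup.centralizer {x} ≤ Subgroup.centralizer {z} := by
    intro a ha
    rw [CommTransitive.mem_centralizer] at ha ⊢
    exact ha.pow_right _
  have he := hM _ _ hle (centralizer_ne_top_of_simple hG hz1) hc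
  rw [he] at hc
  obtain ⟨S, hS⟩ := (hM.isPGroup_centralizer_of_orderOf hG hz hc).exists_le_sylow
  refine ⟨p, this, S, ?_⟩
  rw [he]
  exact hM _ _ hS (S.ne_top_of_isSimpleGroup hG) hc

variable {p : ℕ} [hp : Fact p.Prime] (S : Sylow p G) (hS : ¬ IsMulCommutative S)
include hS

theorem centralizer_le_sylow {u : G} (hu : u ∈ S) (hu1 : u ≠ 1) :
    Subgroup.centralizer {u} ≤ S := by
  have hSt := S.ne_top_of_isSimpleGroup hG
  by_cases hSu : (S : Subgroup G) ≤ Subgroup.centralizer {u}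
  · exact (hM _ _ hSu (centralizer_ne_top_of_simple hG hu1) hS).ge
  have hSb : (S : Subgroup G) ≠ ⊥ := by
    intro h
    have : u ∈ (S : Subgroup G) := hu
    rw [h] at this
    exact hu1 this
  set M := Subgroup.centralizer {u} ⊓ (S : Subgroup G) with hMdef
  have hMS : M < S := lt_of_le_of_ne inf_le_right fun h => hSu (h ▸ inf_le_left)
  have huM : u ∈ M := ⟨CommTransitive.mem_centralizer.2 (Commute.refl u), hu⟩
  have hNS : Subgroup.normalizer (M : Set G) = S := by
    have h1 : Subgroup.normalizer (M : Set G) ⊓ S = S := by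
      refine hM _ _ inf_le_right hSt ?_
      intro hc
      obtain ⟨g, hgS, hgM, hgN⟩ := S.isPGroup'.exists_mem_normalizer hMS
      refine hgM ⟨CommTransitive.mem_centralizer.2 ?_, hgS⟩
      exact Subgroup.isMulCommutative_iff_forall.1 hc g ⟨hgN, hgS⟩ u
        ⟨Subgroup.le_normalizer huM, hu⟩
    refine (hM _ _ (inf_eq_right.1 h1) (normalizer_ne_top_of_simple ?_ ?_) hS).symm
    · intro h
      rw [h] at huM
      exact hu1 huM
    · intro h
      exact hSt (top_le_iff.1 (h ▸ hMS.le))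
  obtain ⟨z, hz, hz1, hzc⟩ := S.isPGroup'.exists_central_ne_one hSb
  have hCz : (S : Subgroup G) = Subgroup.centralizer {z} :=
    hM _ _ (fun s hs => CommTransitive.mem_centralizer.2 (hzc s hs))
      (centralizer_ne_top_of_simple hG hz1) hS
  by_cases hc : IsMulCommutative (Subgroup.centralizer {u})
  · rw [hCz]
    intro a ha
    exact CommTransitive.mem_centralizer.2 (Subgroup.isMulCommutative_iff_forall.1 hc a ha z
      (CommTransitive.mem_centralizer.2 (hzc u hu).symm))
  · exfalso
    obtain ⟨q, hq, P, hP⟩ := hM.exists_sylow_eq_centralizer hG hu1 hc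
    have huP : u ∈ P := by
      change u ∈ (P : Subgroup G)
      rw [← hP]
      exact CommTransitive.mem_centralizer.2 (Commute.refl u)
    have hqp : q = p := by
      by_contra hne
      have := IsPGroup.disjoint_of_ne q p hne (P : Subgroup G) (S : Subgroup G) P.isPGroup'
        S.isPGroup'
      exact hu1 (Subgroup.disjoint_def.1 this huP hu)
    subst hqp
    have hMP : M < P := by
      refine lt_of_le_of_ne (hP ▸ inf_le_left) fun h => ?_
      have h1 : (P : Subgroup G) ≤ S := h ▸ hMS.le
      rw [hP] at hc
      have h2 := hM _ _ h1 hSt hc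
      exact hMS.ne (h.trans h2)
    obtain ⟨g, hgP, hgM, hgN⟩ := P.isPGroup'.exists_mem_normalizer hMP
    refine hgM ⟨hP ▸ hgP, hNS ▸ hgN⟩

theorem sylow_not_noncommutative : False := by
  have hSt := S.ne_top_of_isSimpleGroup hG
  have hSb : (S : Subgroup G) ≠ ⊥ := by
    intro h
    refine hS ?_
    rw [h]
    infer_instance
  obtain ⟨z, hz, hz1, hzc⟩ := S.isPGroup'.exists_central_ne_one hSb
  have hfus : ∀ x ∈ S, x ≠ 1 → ∀ u : G, u * x * u⁻¹ ∈ S → u ∈ S := by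
    intro x hx hx1 u hv
    have h1 : u * z * u⁻¹ ∈ S := by
      refine hM.centralizer_le_sylow hG S hS hv (CommTransitive.conj_ne_one hx1 u) ?_
      rw [CommTransitive.mem_centralizer, CommTransitive.commute_conj_iff]
      exact (hzc x hx).symm
    have h2 : u ∈ Subgroup.normalizer (S : Set G) := by
      refine Subgroup.mem_normalizer_fintype fun s hs => ?_
      refine hM.centralizer_le_sylow hG S hS h1 (CommTransitive.conj_ne_one hz1 u) ?_
      rw [CommTransitive.mem_centralizer, CommTransitive.commute_conj_iff]
      exact hzc s hs
    have h3 := hM.normalizer_eq hS hSt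
    change u ∈ (S : Subgroup G)
    rw [← h3]
    exact h2
  have h1 : (S : Subgroup G).focalSubgroup ≤ ⁅(S : Subgroup G), (S : Subgroup G)⁆ := by
    rw [Subgroup.focalSubgroup_def, Subgroup.closure_le]
    rintro g ⟨hg, x, hx, u, rfl⟩
    by_cases hx1 : x = 1
    · rw [hx1, commutatorElement_one_left]
      exact one_mem _
    · refine Subgroup.commutator_mem_commutator hx (hfus x hx hx1 u ?_)
      have := inv_mem ((S : Subgroup G).mul_mem (inv_mem hx) hg)
      have h : u * x * u⁻¹ ∈ (S : Subgroup G) := by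
        simpa [commutatorElement_def, mul_assoc] using this
      exact h
  have htop : commutator G = ⊤ := by
    rcases (inferInstance : (commutator G).Normal).eq_bot_or_eq_top with h | h
    · refine absurd (Group.isSolvable_of_comm fun a b => ?_) hG
      rw [← commutatorElement_eq_one_iff_mul_comm, ← Subgroup.mem_bot, ← h]
      exact Subgroup.commutator_mem_commutator (Subgroup.mem_top a) (Subgroup.mem_top b)
    · exact h
  have h2 := Subgroup.commutator_inf_eq_focalSubgroup S
  rw [htop, top_inf_eq] at h2
  rw [← h2, ← Subgroup.map_subtype_commutator] at h1
  have h3 : commutator (S : Subgroup G) = ⊤ := by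
    rw [eq_top_iff]
    intro a _
    obtain ⟨b, hb, hab⟩ := Subgroup.mem_map.1 (h1 a.2)
    rwa [← Subtype.ext hab]
  have := S.isPGroup'.isNilpotent
  have : Nontrivial S := (Subgroup.nontrivial_iff_ne_bot _).2 hSb
  have h4 := Group.IsSolvable.commutator_lt_of_ne_bot (G := S) (H := ⊤) top_ne_bot
  exact h4.ne h3

omit hS hp in
theorem commTransitive : CommTransitive G := by
  intro x y w hx hxy hxw
  by_contra hc
  have h1 : ¬ IsMulCommutative (Subgroup.centralizer {x}) := fun h =>
    hc (Subgroup.isMulCommutative_iff_forall.1 h y (CommTransitive.mem_centralizer.2 hxy.symm) w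
      (CommTransitive.mem_centralizer.2 hxw.symm))
  obtain ⟨p, hp, S, hS⟩ := hM.exists_sylow_eq_centralizer hG hx h1
  rw [hS] at h1
  exact hM.sylow_not_noncommutative hG S h1

end NoncommutativeSubgroupsMaximal

theorem BiminimalNonAbelian.noncommutativeSubgroupsMaximal {G : Type*} [Group G]
    (hbi : BiminimalNonAbelian G) : NoncommutativeSubgroupsMaximal G := by
  intro K H hKH hH hK
  rw [Subgroup.isMulCommutative_iff_forall] at hK
  rcases hbi.2.2 H hH with h | h
  · exact absurd (fun a ha b hb => congrArg Subtype.val (h ⟨a, hKH ha⟩ ⟨b, hKH hb⟩)) hK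
  · by_contra hne
    have h1 : K.subgroupOf H ≠ ⊤ := by
      rw [Ne, Subgroup.subgroupOf_eq_top]
      exact fun h => hne (le_antisymm hKH h)
    refine hK fun a ha b hb => ?_
    exact congrArg (fun x : K.subgroupOf H => (x : G))
      (h.2 _ h1 ⟨⟨a, hKH ha⟩, ha⟩ ⟨⟨b, hKH hb⟩, hb⟩)

namespace NoncommutativeSubgroupsMaximal

variable {G : Type*} [Group G] (hM : NoncommutativeSubgroupsMaximal G)
include hM

theorem of_surjective {Q : Type*} [Group Q] (f : G →* Q) (hf : Function.Surjective f) :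
    NoncommutativeSubgroupsMaximal Q := by
  intro K H hKH hH hK
  refine Subgroup.comap_injective hf (hM _ _ (Subgroup.comap_mono hKH) ?_ ?_)
  · intro h
    exact hH (Subgroup.comap_injective hf (by rw [h, Subgroup.comap_top]))
  · intro h
    rw [← Subgroup.map_comap_eq_self_of_surjective hf K] at hK
    exact hK inferInstance

variable [Finite G]

theorem isSolvable_of_ne_top {H : Subgroup G} (hH : H ≠ ⊤) : Group.IsSolvable H :=
  isSolvable_of_forall_proper_isMulCommutative _ rfl (hM.isMulCommutative_of_ne_top hH)

variable (hG : ¬ Group.IsSolvable G)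
include hG

theorem commutator_eq_top : commutator G = ⊤ := by
  by_contra h
  refine hG (isSolvable_of_quotient (commutator G) (hM.isSolvable_of_ne_top h) ?_)
  exact Group.isSolvable_of_comm (G := Abelianization G) mul_comm

theorem monoidHom_eq_one {A : Type*} [Group A] (hA : IsMulCommutative A) (f : G →* A) (x : G) :
    f x = 1 := by
  have : commutator G ≤ f.ker := by
    rw [commutator_def, Subgroup.commutator_le]
    intro a _ b _
    rw [MonoidHom.mem_ker, map_commutatorElement, commutatorElement_eq_one_iff_mul_comm]
    exact hA.is_comm.comm _ _
  rw [hM.commutator_eq_top hG] at this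
  exact this (Subgroup.mem_top x)

theorem isSimpleGroup : IsSimpleGroup G := by
  have hnt : Nontrivial G := by
    by_contra h
    rw [not_nontrivial_iff_subsingleton] at h
    exact hG inferInstance
  obtain ⟨N, ⟨hN, hNt⟩, hmax⟩ :=
    (Set.toFinite {M : Subgroup G | M.Normal ∧ M ≠ ⊤}).exists_maximal
      ⟨⊥, inferInstance, bot_ne_top⟩
  have hmax' : ∀ M : Subgroup G, M.Normal → N < M → M = ⊤ := by
    intro M hMn hlt
    by_contra h
    exact hlt.not_ge (hmax ⟨hMn, h⟩ hlt.le)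
  have hπ := QuotientGroup.mk'_surjective N
  have hQsol : ¬ Group.IsSolvable (G ⧸ N) := fun h =>
    hG (isSolvable_of_quotient N (hM.isSolvable_of_ne_top hNt) h)
  have hQM : NoncommutativeSubgroupsMaximal (G ⧸ N) := hM.of_surjective _ hπ
  have hQnt : Nontrivial (G ⧸ N) := by
    by_contra h
    rw [not_nontrivial_iff_subsingleton] at h
    exact hQsol inferInstance
  have hQs : IsSimpleGroup (G ⧸ N) := by
    refine ⟨fun M hMn => or_iff_not_imp_left.2 fun hb => ?_⟩
    refine Subgroup.comap_injective hπ ?_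
    rw [Subgroup.comap_top]
    refine hmax' _ inferInstance (lt_of_le_of_ne (QuotientGroup.le_comap_mk' N M) fun h => hb ?_)
    refine Subgroup.comap_injective hπ ?_
    rw [← h, MonoidHom.comap_bot, QuotientGroup.ker_mk']
  have hV : ∀ (p : ℕ) [Fact p.Prime], p ∣ Nat.card (G ⧸ N) → ∃ V : Subgroup G,
      IsMulCommutative V ∧ N < V ∧ ¬ p ∣ V.index := by
    intro p hp hpd
    obtain ⟨P⟩ : Nonempty (Sylow p (G ⧸ N)) := inferInstance
    have hPc : IsMulCommutative P := by
      by_contra h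
      exact hQM.sylow_not_noncommutative hQsol P h
    have hNc : ¬ IsMulCommutative (Subgroup.normalizer (P : Set (G ⧸ N))) := by
      intro h
      refine P.ne_top_of_isSimpleGroup hQsol (P.eq_top_of_normalizer_le_centralizer hpd ?_)
      exact (Subgroup.le_centralizer_iff_isMulCommutative.2 h).trans
        (Subgroup.centralizer_le (SetLike.coe_subset_coe.2 Subgroup.le_normalizer))
    have hNt := P.normalizer_ne_top hQsol hpd
    refine ⟨(P : Subgroup (G ⧸ N)).comap (QuotientGroup.mk' N), ?_, ?_, ?_⟩
    · by_contra h
      refine hNc ?_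
      have he := Subgroup.comap_injective hπ
        (hM _ _ (Subgroup.comap_mono (Subgroup.le_normalizer (H := (P : Subgroup (G ⧸ N))))) ?_ h)
      · change IsMulCommutative (Subgroup.normalizer ((P : Subgroup (G ⧸ N)) : Set (G ⧸ N)))
        rw [← he]
        exact hPc
      · intro h
        exact hNt (Subgroup.comap_injective hπ (h.trans (Subgroup.comap_top _).symm))
    · refine lt_of_le_of_ne (QuotientGroup.le_comap_mk' N _) fun h => P.ne_bot_of_dvd_card hpd ?_
      refine Subgroup.comap_injective hπ ?_
      rw [← h, MonoidHom.comap_bot, QuotientGroup.ker_mk']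
    · rw [Subgroup.index_comap_of_surjective _ hπ]
      exact P.not_dvd_index
  have hNcen : N ≤ Subgroup.center G := by
    obtain ⟨p, hp, hpd⟩ := Nat.exists_prime_and_dvd (Finite.one_lt_card (α := G ⧸ N)).ne'
    have := Fact.mk hp
    obtain ⟨V, hVc, hNV, -⟩ := hV p hpd
    have h1 : Subgroup.centralizer (N : Set G) = ⊤ := by
      refine hmax' _ inferInstance (hNV.trans_le ?_)
      exact (Subgroup.le_centralizer_iff_isMulCommutative.2 hVc).trans
        (Subgroup.centralizer_le (SetLike.coe_subset_coe.2 hNV.le))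
    intro x hx
    rw [Subgroup.mem_center_iff]
    intro g
    have : g ∈ Subgroup.centralizer (N : Set G) := h1 ▸ Subgroup.mem_top g
    exact (Subgroup.mem_centralizer_iff.1 this x hx).symm
  have hNbot : N = ⊥ := by
    by_contra hb
    have h1 := (Subgroup.one_lt_card_iff_ne_bot N).2 hb
    obtain ⟨p, hp, hpd⟩ := Nat.exists_prime_and_dvd h1.ne'
    have := Fact.mk hp
    obtain ⟨z, hz⟩ := exists_prime_orderOf_dvd_card' p hpd
    rw [← Subgroup.orderOf_coe] at hz
    obtain ⟨V, hVc, hVi⟩ : ∃ V : Subgroup G, IsMulCommutative V ∧ ¬ p ∣ V.index := by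
      by_cases hd : p ∣ Nat.card (G ⧸ N)
      · obtain ⟨V, hVc, -, hVi⟩ := hV p hd
        exact ⟨V, hVc, hVi⟩
      · refine ⟨N, Subgroup.isMulCommutative_iff_forall.2 fun a _ b hb => ?_, hd⟩
        exact Subgroup.mem_center_iff.1 (hNcen hb) a
    obtain ⟨τ, hτ⟩ := V.exists_transfer_eq_pow_index hVc
    have h2 := hτ z (hNcen z.2)
    rw [hM.monoidHom_eq_one hG hVc τ] at h2
    refine hVi ?_
    rw [← hz]
    exact orderOf_dvd_of_pow_eq_one h2.symm
  refine ⟨fun M hMn => or_iff_not_imp_left.2 fun hb => hmax' M hMn ?_⟩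
  rw [hNbot]
  exact bot_lt_iff_ne_bot.2 hb

end NoncommutativeSubgroupsMaximal

/-- A perfect simple group of order 60 with a subgroup of index 5 is the alternating group. -/
theorem nonempty_mulEquiv_alternatingGroup {G : Type*} [Group G] [Finite G] [IsSimpleGroup G]
    (hperf : ∀ (f : G →* ℤˣ) (x : G), f x = 1) (hcard : Nat.card G = 60) (N : Subgroup G)
    (hN : N.index = 5) : Nonempty (G ≃* alternatingGroup (Fin 5)) := by
  let e : (G ⧸ N) ≃ Fin 5 := Finite.equivFinOfCardEq hN
  let φ : G →* Equiv.Perm (Fin 5) :=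
    (e.permCongrHom.toMonoidHom).comp (MulAction.toPermHom G (G ⧸ N))
  have hinj : Function.Injective φ := by
    have h1 : Function.Injective (MulAction.toPermHom G (G ⧸ N)) := by
      rw [← MonoidHom.ker_eq_bot_iff, ← Subgroup.normalCore_eq_ker]
      refine (Subgroup.normalCore_normal N).eq_bot_or_eq_top.resolve_right fun h => ?_
      have h2 : N = ⊤ := top_le_iff.1 (h ▸ Subgroup.normalCore_le N)
      rw [h2, Subgroup.index_top] at hN
      exact absurd hN (by norm_num)
    exact e.permCongrHom.injective.comp h1
  have hmem : ∀ g, φ g ∈ alternatingGroup (Fin 5) := fun g =>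
    Equiv.Perm.mem_alternatingGroup.2 (hperf (Equiv.Perm.sign.comp φ) g)
  refine ⟨MulEquiv.ofBijective (φ.codRestrict _ hmem) ?_⟩
  refine Function.Injective.bijective_of_nat_card_le ?_ ?_
  · intro a b hab
    exact hinj (congrArg Subtype.val hab)
  · rw [hcard, Nat.card_eq_fintype_card, Fintype.card_congr (Equiv.refl _)]
    have := two_mul_card_alternatingGroup (α := Fin 5)
    rw [Fintype.card_perm, Fintype.card_fin] at this
    have h5 : Nat.factorial 5 = 120 := rfl
    lia

namespace NoncommutativeSubgroupsMaximal

/-- A noncommutative proper subgroup is the semidirect product of any `W` and `⟨y⟩` in it, provided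
`y` normalizes but does not centralize `W`. -/
theorem eq_and_card_eq {G : Type*} [Group G] [Finite G]
    (hM : NoncommutativeSubgroupsMaximal G) {A M W : Subgroup G} {y : G} (hMt : M ≠ ⊤)
    (hAM : A ≤ M) (hyM : y ∈ M) (hWA : W ≤ A) (hyW : y ∈ Subgroup.normalizer (W : Set G))
    (hnc : ∃ w ∈ W, ¬ Commute w y) (hAy : ∀ k : ℤ, y ^ k ∈ A → y ^ k = 1) :
    A = W ∧ Nat.card M = Nat.card A * orderOf y := by
  have hyN : Subgroup.zpowers y ≤ Subgroup.normalizer (W : Set G) := Subgroup.zpowers_le.2 hyW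
  have hsup : W ⊔ Subgroup.zpowers y = M := by
    refine hM _ _ (sup_le (hWA.trans hAM) (Subgroup.zpowers_le.2 hyM)) hMt fun hc => ?_
    obtain ⟨w, hw, hwy⟩ := hnc
    exact hwy (Subgroup.isMulCommutative_iff_forall.1 hc w (Subgroup.mem_sup_left hw) y
      (Subgroup.mem_sup_right (Subgroup.mem_zpowers y)))
  have hmem : ∀ m ∈ M, ∃ w ∈ W, ∃ k : ℤ, w * y ^ k = m := by
    intro m hm
    have h1 : m ∈ ((W ⊔ Subgroup.zpowers y : Subgroup G) : Set G) := by rw [hsup]; exact hm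
    rw [Subgroup.coe_mul_of_right_le_normalizer_left _ _ hyN] at h1
    obtain ⟨w, hw, z, hz, rfl⟩ := Set.mem_mul.1 h1
    obtain ⟨k, rfl⟩ := Subgroup.mem_zpowers_iff.1 hz
    exact ⟨w, hw, k, rfl⟩
  have hAW : A = W := by
    refine le_antisymm (fun a ha => ?_) hWA
    obtain ⟨w, hw, k, rfl⟩ := hmem a (hAM ha)
    have h1 : y ^ k ∈ A := by simpa using A.mul_mem (A.inv_mem (hWA hw)) ha
    rwa [hAy k h1, mul_one]
  refine ⟨hAW, ?_⟩
  rw [← Nat.card_zpowers, ← Nat.card_prod]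
  refine (Nat.card_congr (Equiv.ofBijective
    (fun x : A × Subgroup.zpowers y =>
      (⟨x.1 * x.2, M.mul_mem (hAM x.1.2) (Subgroup.zpowers_le.2 hyM x.2.2)⟩ : M)) ⟨?_, ?_⟩)).symm
  · rintro ⟨⟨a, ha⟩, ⟨z, hz⟩⟩ ⟨⟨b, hb⟩, ⟨z', hz'⟩⟩ h
    have h0 : a * z = b * z' := congrArg Subtype.val h
    have h1 : b⁻¹ * a = z' * z⁻¹ := by
      rw [inv_mul_eq_iff_eq_mul, ← mul_assoc, eq_mul_inv_iff_mul_eq, h0]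
    obtain ⟨k, hk⟩ := Subgroup.mem_zpowers_iff.1 (mul_mem hz' (inv_mem hz))
    have h2 : z' * z⁻¹ = 1 := by
      rw [← hk]
      refine hAy k ?_
      rw [hk, ← h1]
      exact A.mul_mem (A.inv_mem hb) ha
    rw [h2, inv_mul_eq_one] at h1
    have h3 := mul_inv_eq_one.1 h2
    subst h1 h3
    rfl
  · rintro ⟨m, hm⟩
    obtain ⟨w, hw, k, rfl⟩ := hmem m hm
    exact ⟨(⟨w, hWA hw⟩, ⟨y ^ k, Subgroup.mem_zpowers_iff.2 ⟨k, rfl⟩⟩), rfl⟩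

variable {G : Type*} [Group G] [Finite G] [IsSimpleGroup G]

/-- The structure of Sylow `2`-subgroups. -/
theorem sylow_two (hM : NoncommutativeSubgroupsMaximal G) (hG : ¬ Group.IsSolvable G)
    (h2 : 2 ∣ Nat.card G) (S : Sylow 2 G) :
    (∀ t ∈ S, t ≠ 1 → Subgroup.centralizer {t} = S) ∧ (∀ a ∈ S, a * a = 1) ∧
      ∃ q : ℕ, q.Prime ∧
        Nat.card (Subgroup.normalizer (S : Set G)) = Nat.card S * q := by
  have := Fintype.ofFinite G
  have hC := hM.commTransitive hG
  have hSc : IsMulCommutative S := by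
    by_contra h
    exact hM.sylow_not_noncommutative hG S h
  have hScomm := Subgroup.isMulCommutative_iff_forall.1 hSc
  have hpd : 2 ∣ Nat.card S := S.dvd_card_of_dvd_card h2
  obtain ⟨⟨t, htS⟩, ht⟩ := exists_prime_orderOf_dvd_card' 2 hpd
  rw [Subgroup.orderOf_mk] at ht
  have ht1 : t ≠ 1 := by
    rintro rfl
    simp at ht
  have htt : t * t = 1 := by
    rw [← pow_two, ← ht, pow_orderOf_eq_one]
  set A := Subgroup.centralizer {t} with hA
  have memA : ∀ a, a ∈ A ↔ Commute a t := fun a => CommTransitive.mem_centralizer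
  have hAc : ∀ a ∈ A, ∀ b ∈ A, a * b = b * a := fun a ha b hb =>
    hC t a b ht1 ((memA a).1 ha).symm ((memA b).1 hb).symm
  have hSA : (S : Subgroup G) ≤ A := fun s hs => (memA s).2 (hScomm s hs t htS)
  set N := Subgroup.normalizer (S : Set G) with hN
  have hNt : N ≠ ⊤ := S.normalizer_ne_top hG h2
  have hSN : (S : Subgroup G) ≤ N := Subgroup.le_normalizer
  have hNc : ¬ IsMulCommutative N := by
    intro h
    refine S.ne_top_of_isSimpleGroup hG (S.eq_top_of_normalizer_le_centralizer h2 ?_)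
    exact (Subgroup.le_centralizer_iff_isMulCommutative.2 h).trans
      (Subgroup.centralizer_le (SetLike.coe_subset_coe.2 hSN))
  have hAN : A ≤ N := by
    intro a ha
    refine Subgroup.mem_normalizer_fintype fun s hs => ?_
    rw [hAc a ha s (hSA hs), mul_inv_cancel_right]
    exact hs
  have hconj : ∀ g ∈ N, ∀ a ∈ A, g * a * g⁻¹ ∈ A := by
    intro g hg a ha
    have h1 : g * t * g⁻¹ ∈ A := hSA ((Subgroup.mem_normalizer_iff.1 hg t).1 htS)
    rw [memA] at h1 ⊢
    rw [hC.commute_iff ht1 (CommTransitive.conj_ne_one ht1 g) h1.symm,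
      CommTransitive.commute_conj_iff]
    exact (memA a).1 ha
  let W : Subgroup G :=
    { carrier := {a | a ∈ A ∧ a * a = 1}
      one_mem' := ⟨A.one_mem, one_mul 1⟩
      mul_mem' := by
        rintro a b ⟨ha, ha2⟩ ⟨hb, hb2⟩
        refine ⟨A.mul_mem ha hb, ?_⟩
        calc a * b * (a * b) = a * (b * a) * b := by group
          _ = (a * a) * (b * b) := by rw [hAc b hb a ha]; group
          _ = 1 := by rw [ha2, hb2, one_mul]
      inv_mem' := by
        rintro a ⟨ha, ha2⟩
        refine ⟨A.inv_mem ha, ?_⟩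
        rw [← mul_inv_rev, ha2, inv_one] }
  have memW : ∀ a, a ∈ W ↔ a ∈ A ∧ a * a = 1 := fun a => Iff.rfl
  have hkey : ∀ y ∈ N, y ∉ A → A = W ∧ Nat.card N = Nat.card A * orderOf y ∧
      ∀ k : ℤ, y ^ k ∈ A → y ^ k = 1 := by
    intro y hy hyA
    have hAy : ∀ k : ℤ, y ^ k ∈ A → y ^ k = 1 := by
      intro k hk
      by_contra hne
      have h1 : Commute (y ^ k) y := (Commute.refl y).zpow_left k
      exact hyA ((memA y).2 (hC (y ^ k) y t hne h1 ((memA _).1 hk)))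
    have := hM.eq_and_card_eq hNt hAN hy (W := W) (fun a ha => ha.1) ?_
      ⟨t, ⟨(memA t).2 (Commute.refl t), htt⟩, fun h => hyA ((memA y).2 h.symm)⟩ hAy
    · exact ⟨this.1, this.2, hAy⟩
    · refine Subgroup.mem_normalizer_fintype fun a ha => ?_
      obtain ⟨ha, ha2⟩ := ha
      refine ⟨hconj y hy a ha, ?_⟩
      calc y * a * y⁻¹ * (y * a * y⁻¹) = y * (a * a) * y⁻¹ := by group
        _ = 1 := by rw [ha2]; group
  obtain ⟨y, hyN, hyA⟩ : ∃ y ∈ N, y ∉ A := by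
    by_contra! h
    exact hNc (Subgroup.isMulCommutative_iff_forall.2 fun a ha b hb =>
      hAc a (h a ha) b (h b hb))
  obtain ⟨hAW, hcard, hAy⟩ := hkey y hyN hyA
  have hA2 : ∀ a ∈ A, a * a = 1 := fun a ha => by
    rw [hAW] at ha
    exact ha.2
  have hAS : A = S := by
    refine S.is_maximal' ?_ hSA
    exact fun a => ⟨1, Subtype.ext (by simpa [pow_two] using hA2 a a.2)⟩
  refine ⟨fun s hs hs1 => ?_, fun a ha => hA2 a (hSA ha), orderOf y, ?_, ?_⟩
  · rw [← hAS]
    ext a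
    rw [memA, CommTransitive.mem_centralizer]
    exact hC.commute_iff hs1 ht1 (hScomm s hs t htS) a
  · have hy1 : orderOf y ≠ 1 := by
      rw [Ne, orderOf_eq_one_iff]
      rintro rfl
      exact hyA A.one_mem
    obtain ⟨p, hp, hpd⟩ := Nat.exists_prime_and_dvd hy1
    have hz : orderOf (y ^ (orderOf y / p)) = p := by
      rw [orderOf_pow_of_dvd (Nat.div_pos (Nat.le_of_dvd (orderOf_pos y) hpd) hp.pos).ne'
        (Nat.div_dvd_of_dvd hpd), Nat.div_div_self hpd (orderOf_pos y).ne']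
    have hzA : y ^ (orderOf y / p) ∉ A := by
      intro h
      have := hAy (orderOf y / p : ℕ) (by rwa [zpow_natCast])
      rw [zpow_natCast] at this
      rw [this, orderOf_one] at hz
      exact hp.one_lt.ne hz
    obtain ⟨-, hcard', -⟩ := hkey _ (pow_mem hyN _) hzA
    rw [hz, hcard] at hcard'
    rw [Nat.eq_of_mul_eq_mul_left Nat.card_pos hcard']
    exact hp
  · rw [hcard, hAS]

end NoncommutativeSubgroupsMaximal

/-- `s` is an involution inverting `x` and not commuting with it. -/
def ProperlyInverts {G : Type*} [Group G] (s x : G) : Prop :=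
  s * s = 1 ∧ s * x * s = x⁻¹ ∧ ¬ Commute s x

namespace ProperlyInverts

variable {G : Type*} [Group G] {s x : G}

theorem ne_one (h : ProperlyInverts s x) : s ≠ 1 := by
  rintro rfl
  exact h.2.2 (Commute.one_left x)

theorem ne_one_right (h : ProperlyInverts s x) : x ≠ 1 := by
  rintro rfl
  exact h.2.2 (Commute.one_right s)

theorem inv_eq (h : ProperlyInverts s x) : s⁻¹ = s := inv_eq_of_mul_eq_one_left h.1

theorem conj_zpow (h : ProperlyInverts s x) (k : ℤ) : s * x ^ k * s = (x ^ k)⁻¹ := by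
  have h1 : s * x * s⁻¹ = x⁻¹ := by rw [h.inv_eq]; exact h.2.1
  have := _root_.conj_zpow (a := s) (b := x) (i := k)
  rw [h1, h.inv_eq, inv_zpow] at this
  exact this.symm

theorem of_zpow (hC : CommTransitive G) (h : ProperlyInverts s x) {k : ℤ} (hk : x ^ k ≠ 1) :
    ProperlyInverts s (x ^ k) := by
  refine ⟨h.1, h.conj_zpow k, fun hc => h.2.2 ?_⟩
  exact hC (x ^ k) s x hk hc.symm ((Commute.refl x).zpow_left k)

theorem conj (h : ProperlyInverts s x) (g : G) :
    ProperlyInverts (g * s * g⁻¹) (g * x * g⁻¹) := by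
  refine ⟨?_, ?_, ?_⟩
  · calc g * s * g⁻¹ * (g * s * g⁻¹) = g * (s * s) * g⁻¹ := by group
      _ = 1 := by rw [h.1]; group
  · calc g * s * g⁻¹ * (g * x * g⁻¹) * (g * s * g⁻¹) = g * (s * x * s) * g⁻¹ := by group
      _ = (g * x * g⁻¹)⁻¹ := by rw [h.2.1]; group
  · rw [CommTransitive.commute_conj_iff]
    exact h.2.2

theorem mul_left_iff : ProperlyInverts s (s * x) ↔ s * s = 1 ∧ x * x = 1 ∧ ¬ Commute s x := by
  unfold ProperlyInverts
  refine and_congr_right fun hs => ?_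
  have hs' : s⁻¹ = s := inv_eq_of_mul_eq_one_left hs
  have h1 : s * (s * x) * s = x * s := by rw [← mul_assoc, hs, one_mul]
  have h2 : Commute s (s * x) ↔ Commute s x := by
    constructor
    · intro h
      have := (Commute.refl s).inv_right.mul_right h
      rwa [inv_mul_cancel_left] at this
    · exact fun h => (Commute.refl s).mul_right h
  rw [h1, h2, mul_inv_rev, hs', mul_left_inj, eq_inv_iff_mul_eq_one]

section Simple

variable [Finite G] [IsSimpleGroup G]

theorem centralizer_eq (hM : NoncommutativeSubgroupsMaximal G) (hG : ¬ Group.IsSolvable G)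
    (h : ProperlyInverts s x) :
    (orderOf x).Prime ∧ orderOf x ≠ 2 ∧ Subgroup.centralizer {x} = Subgroup.zpowers x ∧
      Nat.card (Subgroup.normalizer (Subgroup.centralizer {x} : Set G)) = orderOf x * 2 := by
  have hC := hM.commTransitive hG
  have hx1 := h.ne_one_right
  set B := Subgroup.centralizer {x} with hB
  have memB : ∀ a, a ∈ B ↔ Commute a x := fun a => CommTransitive.mem_centralizer
  have hxB : x ∈ B := (memB x).2 (Commute.refl x)
  set M := Subgroup.normalizer (Subgroup.zpowers x : Set G) with hMdef
  have hMt : M ≠ ⊤ := by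
    refine normalizer_ne_top_of_simple (by simpa using hx1) fun ht => hG ?_
    refine Group.isSolvable_of_comm fun a b => ?_
    exact Subgroup.isMulCommutative_iff_forall.1
      (inferInstance : IsMulCommutative (Subgroup.zpowers x)) a (ht ▸ Subgroup.mem_top a) b
        (ht ▸ Subgroup.mem_top b)
  have hsN : ∀ k : ℤ, s ∈ Subgroup.normalizer (Subgroup.zpowers (x ^ k) : Set G) := by
    intro k
    refine Subgroup.mem_normalizer_fintype fun a ha => ?_
    obtain ⟨j, rfl⟩ := Subgroup.mem_zpowers_iff.1 ha
    rw [← zpow_mul, h.inv_eq, h.conj_zpow, zpow_mul]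
    exact inv_mem ha
  have hBM : B ≤ M := by
    intro a ha
    refine Subgroup.mem_normalizer_fintype fun b hb => ?_
    have : Commute a b := ((memB a).1 ha).of_mem_zpowers hb
    rw [this.eq, mul_inv_cancel_right]
    exact hb
  have hsB : s ∉ B := fun hs => h.2.2 ((memB s).1 hs)
  have hso : orderOf s = 2 := orderOf_eq_prime (by rw [pow_two, h.1]) h.ne_one
  have hkey : ∀ k : ℤ, x ^ k ≠ 1 → B = Subgroup.zpowers (x ^ k) ∧
      Nat.card M = Nat.card B * 2 := by
    intro k hk
    rw [← hso]
    refine hM.eq_and_card_eq hMt hBM (by simpa using hsN 1) ?_ (hsN k)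
      ⟨x ^ k, Subgroup.mem_zpowers _, fun hc => (h.of_zpow hC hk).2.2 hc.symm⟩ ?_
    · rw [Subgroup.zpowers_le]
      exact zpow_mem hxB k
    · intro j hj
      obtain ⟨i, rfl | rfl⟩ := Int.even_or_odd' j
      · rw [zpow_mul, zpow_ofNat, pow_two, h.1, one_zpow]
      · rw [zpow_add, zpow_mul, zpow_ofNat, pow_two, h.1, one_zpow, one_mul, zpow_one] at hj
        exact absurd hj hsB
  obtain ⟨hBx, hcard⟩ := hkey 1 (by simpa using hx1)
  rw [zpow_one] at hBx
  refine ⟨?_, ?_, hBx, ?_⟩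
  · obtain ⟨p, hp, hpd⟩ := Nat.exists_prime_and_dvd (mt orderOf_eq_one_iff.1 hx1)
    have hz : orderOf (x ^ (orderOf x / p)) = p := by
      rw [orderOf_pow_of_dvd (Nat.div_pos (Nat.le_of_dvd (orderOf_pos x) hpd) hp.pos).ne'
        (Nat.div_dvd_of_dvd hpd), Nat.div_div_self hpd (orderOf_pos x).ne']
    have hz1 : x ^ ((orderOf x / p : ℕ) : ℤ) ≠ 1 := by
      rw [zpow_natCast]
      intro h
      rw [h, orderOf_one] at hz
      exact hp.one_lt.ne hz
    have := (hkey _ hz1).1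
    rw [hBx, zpow_natCast] at this
    rw [← Nat.card_zpowers, this, Nat.card_zpowers, hz]
    exact hp
  · intro h2
    refine h.2.2 ?_
    have h3 : x⁻¹ = x := inv_eq_of_mul_eq_one_left (by rw [← pow_two, ← h2, pow_orderOf_eq_one])
    have h4 := h.2.1
    rw [h3] at h4
    calc s * x = s * x * (s * s) := by rw [h.1, mul_one]
      _ = s * x * s * s := by group
      _ = x * s := by rw [h4]
  · rw [hBx, ← hMdef, hcard, hBx, Nat.card_zpowers]

/-- Properly inverted elements of the same order are conjugate up to powers. -/
theorem mem_fam [Fintype G] (hM : NoncommutativeSubgroupsMaximal G) (hG : ¬ Group.IsSolvable G)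
    (h : ProperlyInverts s x) {y : G} :
    y ∈ CommTransitive.fam x ↔ orderOf y = orderOf x ∧ ∃ t, ProperlyInverts t y := by
  have hC := hM.commTransitive hG
  obtain ⟨hp, -, hcx, -⟩ := h.centralizer_eq hM hG
  rw [CommTransitive.mem_fam]
  constructor
  · rintro ⟨hy1, g, hg⟩
    have h1 : g * y * g⁻¹ ∈ Subgroup.zpowers x := by
      rw [← hcx, CommTransitive.mem_centralizer]
      exact hg
    obtain ⟨k, hk⟩ := Subgroup.mem_zpowers_iff.1 h1
    have hk1 : x ^ k ≠ 1 := by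
      rw [hk]
      exact CommTransitive.conj_ne_one hy1 g
    have h2 : orderOf (g * y * g⁻¹) = orderOf y := by
      simpa [MulAut.conj_apply] using MulEquiv.orderOf_eq (MulAut.conj g) y
    have h3 : orderOf (x ^ k) ∣ orderOf x := by
      rw [orderOf_dvd_iff_pow_eq_one, ← zpow_natCast, ← zpow_mul, mul_comm, zpow_mul,
        zpow_natCast, pow_orderOf_eq_one, one_zpow]
    refine ⟨?_, g⁻¹ * s * g⁻¹⁻¹, ?_⟩
    · rw [← h2, ← hk]
      exact ((Nat.dvd_prime hp).1 h3).resolve_left (mt orderOf_eq_one_iff.1 hk1)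
    · have h4 := (h.of_zpow hC hk1).conj g⁻¹
      rw [hk] at h4
      simpa [mul_assoc] using h4
  · rintro ⟨ho, t, ht⟩
    refine ⟨ht.ne_one_right, ?_⟩
    have := Fact.mk hp
    have hsyl : ∀ z : G, orderOf z = orderOf x → Subgroup.centralizer {z} = Subgroup.zpowers z →
        ∃ P : Sylow (orderOf x) G, (P : Subgroup G) = Subgroup.zpowers z := by
      intro z hz hcz
      have hpz : IsPGroup (orderOf x) (Subgroup.zpowers z) :=
        IsPGroup.iff_card.2 ⟨1, by rw [Nat.card_zpowers, hz, pow_one]⟩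
      obtain ⟨P, hP⟩ := hpz.exists_le_sylow
      refine ⟨P, le_antisymm ?_ hP⟩
      have hPc : IsMulCommutative P := by
        by_contra h
        exact hM.sylow_not_noncommutative hG P h
      intro a ha
      rw [← hcz, CommTransitive.mem_centralizer]
      exact Subgroup.isMulCommutative_iff_forall.1 hPc a ha z (hP (Subgroup.mem_zpowers z))
    obtain ⟨P, hP⟩ := hsyl x rfl hcx
    obtain ⟨Q, hQ⟩ := hsyl y ho (ht.centralizer_eq hM hG).2.2.1
    obtain ⟨g, rfl⟩ := MulAction.exists_smul_eq G Q P
    refine ⟨g, ?_⟩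
    rw [← CommTransitive.mem_centralizer, hcx, ← hP]
    have : y ∈ (Q : Subgroup G) := hQ ▸ Subgroup.mem_zpowers y
    exact Subgroup.mem_map_of_mem (MulAut.conj g).toMonoidHom this

end Simple

end ProperlyInverts

theorem CommTransitive.card_normalizer_mul_card_fam {G : Type*} [Group G] [Fintype G]
    (hC : CommTransitive G) {x : G} (hx : x ≠ 1) :
    Nat.card (Subgroup.normalizer (Subgroup.centralizer {x} : Set G)) * (fam x).card =
      Nat.card G * (punct x).card := by
  have h1 := hC.mul_sum_fam hx (fun _ => 1) (fun _ _ => rfl)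
  simp only [Finset.sum_const, nsmul_eq_mul, mul_one] at h1
  rw [Nat.card_eq_fintype_card (α := G)]
  exact_mod_cast h1

namespace ProperlyInverts

variable {G : Type*} [Group G] [Fintype G]

open scoped Classical in
theorem card_filter_right (s : G) (hs : s * s = 1) :
    (Finset.univ.filter fun t : G => t ≠ 1 ∧ t * t = 1).card =
      (Finset.univ.filter fun t : G => (t ≠ 1 ∧ t * t = 1) ∧ Commute t s).card +
      (Finset.univ.filter fun x => ProperlyInverts s x).card := by
  rw [← Finset.card_filter_add_card_filter_not
      (s := Finset.univ.filter fun t : G => t ≠ 1 ∧ t * t = 1)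
    (fun t => Commute t s), Finset.filter_filter, Finset.filter_filter]
  congr 1
  have hss : ∀ t, s * (s * t) = t := fun t => by rw [← mul_assoc, hs, one_mul]
  refine Finset.card_bij' (fun t _ => s * t) (fun x _ => s * x) ?_ ?_ ?_ ?_
  · intro t ht
    simp only [Finset.mem_filter, Finset.mem_univ, true_and] at ht ⊢
    exact mul_left_iff.2 ⟨hs, ht.1.2, fun hc => ht.2 hc.symm⟩
  · intro x hx
    simp only [Finset.mem_filter, Finset.mem_univ, true_and] at hx ⊢
    rw [← hss x, mul_left_iff] at hx
    refine ⟨⟨?_, hx.2.1⟩, fun hc => hx.2.2 hc.symm⟩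
    intro h1
    exact hx.2.2 (h1 ▸ Commute.one_right s)
  · exact fun t _ => hss t
  · exact fun t _ => hss t

variable [IsSimpleGroup G]

open scoped Classical in
/-- The inverting involutions of `x` form a coset of the centralizer of `x`. -/
theorem card_filter_left (hM : NoncommutativeSubgroupsMaximal G) (hG : ¬ Group.IsSolvable G)
    {s x : G} (h : ProperlyInverts s x) :
    (Finset.univ.filter fun t => ProperlyInverts t x).card = orderOf x := by
  obtain ⟨-, -, hcx, -⟩ := h.centralizer_eq hM hG
  have hmem : ∀ a, Commute a x ↔ a ∈ Subgroup.zpowers x := fun a => by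
    rw [← hcx, CommTransitive.mem_centralizer]
  rw [← Nat.card_zpowers, Nat.card_eq_fintype_card, ← Finset.card_univ]
  refine (Finset.card_bij (fun (a : Subgroup.zpowers x) _ => s * (a : G)) ?_ ?_ ?_).symm
  · rintro ⟨a, ha⟩ -
    obtain ⟨k, rfl⟩ := Subgroup.mem_zpowers_iff.1 ha
    have hk : s * x ^ k * s = (x ^ k)⁻¹ := h.conj_zpow k
    rw [Finset.mem_filter]
    refine ⟨Finset.mem_univ _, ?_, ?_, ?_⟩
    · calc s * x ^ k * (s * x ^ k) = s * x ^ k * s * x ^ k := by group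
        _ = 1 := by rw [hk, inv_mul_cancel]
    · calc s * x ^ k * x * (s * x ^ k) = s * x ^ k * (s * s) * x * s * x ^ k := by
            rw [h.1]; group
        _ = (s * x ^ k * s) * (s * x * s) * x ^ k := by group
        _ = x⁻¹ := by rw [hk, h.2.1]; group
    · intro hc
      refine h.2.2 ?_
      have h2 : Commute (x ^ k)⁻¹ x := ((Commute.refl x).zpow_left k).inv_left
      have := hc.mul_left h2
      rwa [mul_inv_cancel_right] at this
  · intro a _ b _ hab
    exact Subtype.ext (mul_left_cancel hab)
  · intro t ht
    rw [Finset.mem_filter] at ht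
    obtain ⟨-, ht⟩ := ht
    refine ⟨⟨s * t, (hmem _).1 ?_⟩, Finset.mem_univ _, ?_⟩
    · have h1 : t * x * t = s * x * s := by rw [ht.2.1, h.2.1]
      calc s * t * x = s * (t * x * t) * t := by
            have := ht.1
            calc s * t * x = s * t * x * (t * t) := by rw [this, mul_one]
              _ = _ := by group
        _ = s * (s * x * s) * t := by rw [h1]
        _ = s * s * x * s * t := by group
        _ = x * (s * t) := by rw [h.1]; group
    · change s * (s * t) = t
      rw [← mul_assoc, h.1, one_mul]

open scoped Classical in
/-- Summing the orders of the properly inverted elements. -/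
theorem two_mul_sum_orderOf (hM : NoncommutativeSubgroupsMaximal G)
    (hG : ¬ Group.IsSolvable G) :
    2 * ∑ x ∈ Finset.univ.filter (fun x : G => ∃ s, ProperlyInverts s x), orderOf x =
      Nat.card G * ∑ p ∈ (Finset.univ.filter fun x : G => ∃ s, ProperlyInverts s x).image orderOf,
        (p - 1) := by
  have hC := hM.commTransitive hG
  set X := Finset.univ.filter fun x : G => ∃ s, ProperlyInverts s x with hX
  rw [← Finset.sum_fiberwise_of_maps_to (g := orderOf) (t := X.image orderOf)
    (fun x hx => Finset.mem_image_of_mem _ hx), Finset.mul_sum, Finset.mul_sum]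
  refine Finset.sum_congr rfl fun p hp => ?_
  obtain ⟨x, hx, rfl⟩ := Finset.mem_image.1 hp
  obtain ⟨-, s, h⟩ := Finset.mem_filter.1 hx
  obtain ⟨-, -, hcx, hN⟩ := h.centralizer_eq hM hG
  have hf : X.filter (fun y => orderOf y = orderOf x) = CommTransitive.fam x := by
    ext y
    rw [h.mem_fam hM hG, Finset.mem_filter, hX, Finset.mem_filter]
    simp [and_comm]
  rw [hf, Finset.sum_congr rfl (fun y hy => ((h.mem_fam hM hG).1 hy).1), Finset.sum_const,
    smul_eq_mul]
  have h1 := hC.card_normalizer_mul_card_fam h.ne_one_right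
  have h2 := CommTransitive.card_punct x
  rw [hcx, Nat.card_zpowers] at h2
  rw [hN] at h1
  rw [← h2, Nat.add_sub_cancel, ← h1, h2]
  ring

end ProperlyInverts

open scoped Classical in
/-- The numerical constraints on the order of a simple group in which noncommutative subgroups are
maximal. -/
theorem NoncommutativeSubgroupsMaximal.exists_sylow_two {G : Type*} [Group G] [Finite G]
    [IsSimpleGroup G] (hM : NoncommutativeSubgroupsMaximal G) (hG : ¬ Group.IsSolvable G)
    (h2 : 2 ∣ Nat.card G) :
    ∃ (S : Sylow 2 G) (q w k : ℕ) (P : Finset ℕ), q.Prime ∧ Nat.card S = w * q + 1 ∧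
      (Subgroup.normalizer (S : Set G)).index = k + 1 ∧ 0 < k ∧
      Nat.card G = Nat.card S * q * (k + 1) ∧
      (∀ p ∈ P, p.Prime ∧ p ≠ 2 ∧ p ∣ Nat.card G) ∧
      2 * (w * q) ^ 2 * k = Nat.card S * q * ∑ p ∈ P, (p - 1) := by
  have := Fintype.ofFinite G
  have hC := hM.commTransitive hG
  have := Fact.mk Nat.prime_two
  obtain ⟨S⟩ := (inferInstance : Nonempty (Sylow 2 G))
  obtain ⟨hcS, hinv, q, hq, hNS⟩ := hM.sylow_two hG h2 S
  obtain ⟨t₀, ht₀S, ht₀⟩ : ∃ t ∈ (S : Subgroup G), t ≠ 1 :=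
    (Subgroup.ne_bot_iff_exists_ne_one.1 (S.ne_bot_of_dvd_card h2)).elim
      fun t ht => ⟨t, t.2, fun h => ht (Subtype.ext h)⟩
  have hc₀ : Subgroup.centralizer {t₀} = (S : Subgroup G) := hcS t₀ ht₀S ht₀
  set T := Finset.univ.filter fun t : G => t ≠ 1 ∧ t * t = 1 with hT
  have hsyl : ∀ t : G, t ≠ 1 → t * t = 1 → ∃ R : Sylow 2 G, t ∈ (R : Subgroup G) := by
    intro t ht htt
    have hp : IsPGroup 2 (Subgroup.zpowers t) := IsPGroup.iff_card.2 ⟨1, by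
      rw [Nat.card_zpowers, pow_one]
      exact orderOf_eq_prime (by rw [pow_two, htt]) ht⟩
    obtain ⟨R, hR⟩ := hp.exists_le_sylow
    exact ⟨R, hR (Subgroup.mem_zpowers t)⟩
  have hTfam : T = CommTransitive.fam t₀ := by
    ext t
    rw [hT, Finset.mem_filter, CommTransitive.mem_fam]
    simp only [Finset.mem_univ, true_and]
    refine and_congr_right fun ht => ⟨fun htt => ?_, ?_⟩
    · obtain ⟨R, hR⟩ := hsyl t ht htt
      obtain ⟨g, rfl⟩ := MulAction.exists_smul_eq G R S
      refine ⟨g, ?_⟩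
      rw [← CommTransitive.mem_centralizer, hc₀]
      exact Subgroup.mem_map_of_mem (MulAut.conj g).toMonoidHom hR
    · rintro ⟨g, hg⟩
      rw [← CommTransitive.mem_centralizer, hc₀] at hg
      have h1 := hinv _ hg
      have h3 : g * (t * t) * g⁻¹ = 1 := by rw [← h1]; group
      simpa using h3
  have hcard : ∀ s ∈ T, (Finset.univ.filter fun t : G => (t ≠ 1 ∧ t * t = 1) ∧ Commute t s).card + 1
      = Nat.card S := by
    intro s hs
    obtain ⟨-, hs1, hss⟩ := Finset.mem_filter.1 hs
    obtain ⟨R, hR⟩ := hsyl s hs1 hss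
    obtain ⟨hcR, hinvR, -⟩ := hM.sylow_two hG h2 R
    rw [hTfam] at hs
    rw [← hc₀, ← hC.card_centralizer_eq ht₀ hs, ← CommTransitive.card_punct s]
    congr 2
    ext t
    rw [Finset.mem_filter, CommTransitive.mem_punct]
    simp only [Finset.mem_univ, true_and, and_assoc]
    refine and_congr_right fun ht => ⟨fun h => h.2, fun h => ⟨hinvR t ?_, h⟩⟩
    rw [← CommTransitive.mem_centralizer, hcR s hR hs1] at h
    exact h
  have hN₀ : Nat.card (Subgroup.normalizer (Subgroup.centralizer {t₀} : Set G)) =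
      Nat.card (Subgroup.centralizer {t₀}) * q := by
    rw [hc₀]
    exact hNS
  have hw := hC.card_classes ht₀ q hN₀
  have hpT := CommTransitive.card_punct t₀
  have hTc := hC.card_normalizer_mul_card_fam ht₀
  rw [hN₀, ← hTfam] at hTc
  rw [hc₀] at hw hpT hTc
  set w := ((CommTransitive.fam t₀).image ConjClasses.mk).card
  have hidx := Subgroup.card_mul_index (Subgroup.normalizer (S : Set G))
  rw [hNS] at hidx
  have hNt : Subgroup.normalizer (S : Set G) ≠ ⊤ :=
    Sylow.normalizer_ne_top hG h2 S
  have hidx1 : (Subgroup.normalizer (S : Set G)).index ≠ 1 := mt Subgroup.index_eq_one.1 hNt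
  have hidx0 : (Subgroup.normalizer (S : Set G)).index ≠ 0 := Subgroup.index_ne_zero_of_finite
  obtain ⟨k, hk⟩ : ∃ k, (Subgroup.normalizer (S : Set G)).index = k + 1 :=
    Nat.exists_eq_succ_of_ne_zero hidx0
  rw [hk] at hidx
  set X := Finset.univ.filter fun x : G => ∃ s, ProperlyInverts s x with hX
  refine ⟨S, q, w, k, X.image orderOf, hq, hw.symm, hk, by lia, hidx.symm, ?_, ?_⟩
  · intro p hp
    obtain ⟨x, hx, rfl⟩ := Finset.mem_image.1 hp
    obtain ⟨-, s, h⟩ := Finset.mem_filter.1 hx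
    obtain ⟨h3, h4, -⟩ := h.centralizer_eq hM hG
    exact ⟨h3, h4, orderOf_dvd_natCard x⟩
  have hcount : T.card * T.card = T.card * (w * q) + ∑ x ∈ X, orderOf x := by
    have h3 : ∑ s ∈ T, (Finset.univ.filter fun x => ProperlyInverts s x).card =
        ∑ x : G, (T.filter fun s => ProperlyInverts s x).card :=
      Finset.sum_card_bipartiteAbove_eq_sum_card_bipartiteBelow _
    have h4 : ∑ x : G, (T.filter fun s => ProperlyInverts s x).card = ∑ x ∈ X, orderOf x := by
      rw [hX, Finset.sum_filter]
      refine Finset.sum_congr rfl fun x _ => ?_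
      split_ifs with hx
      · obtain ⟨s, h⟩ := hx
        rw [← h.card_filter_left hM hG]
        congr 1
        ext t
        simp only [hT, Finset.mem_filter, Finset.mem_univ, true_and]
        exact ⟨fun h => h.2, fun h => ⟨⟨h.ne_one, h.1⟩, h⟩⟩
      · rw [Finset.card_eq_zero, Finset.filter_eq_empty_iff]
        exact fun t _ h => hx ⟨t, h⟩
    rw [← h4, ← h3, ← smul_eq_mul, ← smul_eq_mul, ← Finset.sum_const, ← Finset.sum_const,
      ← Finset.sum_add_distrib]
    refine Finset.sum_congr rfl fun s hs => ?_
    have h5 := hcard s hs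
    rw [hT, ProperlyInverts.card_filter_right s (Finset.mem_filter.1 hs).2.2]
    lia
  have hsum := ProperlyInverts.two_mul_sum_orderOf hM hG
  rw [← hX] at hsum
  have hn : 0 < Nat.card S := Nat.card_pos
  have hTm : T.card = (k + 1) * (w * q) := by
    refine Nat.eq_of_mul_eq_mul_left (Nat.mul_pos hn hq.pos) ?_
    have h6 : (CommTransitive.punct t₀).card = w * q := by lia
    have h7 : Nat.card S * q * T.card = Nat.card G * (CommTransitive.punct t₀).card := hTc
    rw [h7, h6, ← hidx]
    ring
  rw [← hidx] at hsum
  rw [hTm] at hcount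
  refine Nat.eq_of_mul_eq_mul_left (Nat.succ_pos k) ?_
  have h8 : 2 * ∑ x ∈ X, orderOf x = Nat.card S * q * (k + 1) * ∑ p ∈ X.image orderOf, (p - 1) :=
    hsum
  generalize ∑ x ∈ X, orderOf x = A at *
  generalize ∑ p ∈ X.image orderOf, (p - 1) = D at *
  generalize Nat.card S = n at *
  zify at *
  linear_combination 2 * hcount + h8

namespace Finset

theorem sum_sub_one_lt_prod (s : Finset ℕ) (hs : ∀ p ∈ s, 0 < p) :
    ∑ p ∈ s, (p - 1) < ∏ p ∈ s, p := by
  induction s using Finset.induction_on with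
  | empty => simp
  | insert p s hp ih =>
    rw [sum_insert hp, prod_insert hp]
    have h1 := ih fun r hr => hs r (mem_insert_of_mem hr)
    have h2 := hs p (mem_insert_self p s)
    obtain ⟨r, rfl⟩ := Nat.exists_eq_succ_of_ne_zero h2.ne'
    generalize ∑ p ∈ s, (p - 1) = A at *
    generalize ∏ p ∈ s, p = B at *
    simp only [Nat.succ_eq_add_one, Nat.add_sub_cancel]
    nlinarith

end Finset

theorem two_pow_eq_four_of_sum_eq {n a q w k : ℕ} {P : Finset ℕ} (hn : n = 2 ^ a) (ha : a ≠ 0)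
    (hw : n = w * q + 1) (hq : q.Prime) (hk : 0 < k)
    (hP : ∀ p ∈ P, p.Prime ∧ p ≠ 2 ∧ p ∣ n * q * (k + 1))
    (hD : 2 * (w * q) ^ 2 * k = n * q * ∑ p ∈ P, (p - 1)) : n = 4 ∧ q = 3 ∧ k = 4 := by
  have h2n : 2 ∣ n := hn ▸ dvd_pow_self 2 ha
  have hw0 : 0 < w := by
    rcases Nat.eq_zero_or_pos w with rfl | h
    · rw [zero_mul, zero_add] at hw
      lia
    · exact h
  have hcop : Nat.Coprime n ((w * q) ^ 2) := by
    refine Nat.Coprime.pow_right 2 ?_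
    rw [hw]
    simp
  have hodd : ∀ p ∈ P, 2 ∣ p - 1 := by
    intro p hp
    obtain ⟨h1, h2, -⟩ := hP p hp
    obtain ⟨r, rfl⟩ := h1.odd_of_ne_two h2
    simp
  obtain ⟨D, hDe⟩ : 2 ∣ ∑ p ∈ P, (p - 1) := Finset.dvd_sum hodd
  have hD2 : (w * q) ^ 2 * k = n * q * D := by
    rw [hDe] at hD
    lia
  obtain ⟨s, rfl⟩ : n ∣ k :=
    hcop.dvd_of_dvd_mul_left ⟨q * D, by rw [hD2, mul_assoc]⟩
  have hs : 0 < s := Nat.pos_of_mul_pos_left hk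
  have hD3 : w * w * q * s = D := by
    have hn0 : 0 < n := by lia
    refine Nat.eq_of_mul_eq_mul_left (Nat.mul_pos hn0 hq.pos) ?_
    rw [← hD2]
    ring
  set R := P.erase q with hR
  have hRp : ∀ p ∈ R, p.Prime := fun p hp => (hP p (Finset.mem_of_mem_erase hp)).1
  have hprod : ∏ p ∈ R, p ∣ n * s + 1 := by
    refine Finset.prod_primes_dvd _ (fun p hp => (hRp p hp).prime) fun p hp => ?_
    obtain ⟨hpq, hpP⟩ := Finset.mem_erase.1 hp
    obtain ⟨h1, h2, h3⟩ := hP p hpP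
    rcases h1.dvd_mul.1 h3 with h | h
    · rcases h1.dvd_mul.1 h with h | h
      · rw [hn] at h
        exact absurd ((Nat.prime_dvd_prime_iff_eq h1 Nat.prime_two).1 (h1.dvd_of_dvd_pow h)) h2
      · exact absurd ((Nat.prime_dvd_prime_iff_eq h1 hq).1 h) hpq
    · exact h
  have hle := Nat.le_of_dvd (Nat.succ_pos _) hprod
  have hlt := R.sum_sub_one_lt_prod fun p hp => (hRp p hp).pos
  have hsum : ∑ p ∈ P, (p - 1) ≤ ∑ p ∈ R, (p - 1) + (q - 1) := by
    by_cases hqP : q ∈ P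
    · rw [hR, Finset.sum_erase_add _ _ hqP]
    · rw [hR, Finset.erase_eq_of_notMem hqP]
      exact Nat.le_add_right _ _
  have hq2 := hq.two_le
  obtain ⟨rfl, rfl⟩ : w = 1 ∧ s = 1 := by
    have h1 : 2 * (w * w * q * s) ≤ w * q * s + s + (q - 1) := by
      rw [hDe, ← hD3] at hsum
      have : n * s = w * q * s + s := by rw [hw]; ring
      lia
    obtain ⟨q', rfl⟩ : ∃ q', q = q' + 2 := ⟨q - 2, by lia⟩
    obtain ⟨w', rfl⟩ : ∃ w', w = w' + 1 := ⟨w - 1, by lia⟩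
    obtain ⟨s', rfl⟩ : ∃ s', s = s' + 1 := ⟨s - 1, by lia⟩
    have h2 : q' + 2 - 1 = q' + 1 := by lia
    rw [h2] at h1
    ring_nf at h1
    constructor
    · by_contra h
      have : 0 < w' := by lia
      nlinarith [Nat.zero_le (w' * q' * s'), Nat.zero_le (w' ^ 2 * q' * s'), Nat.zero_le (w' * q'),
        Nat.zero_le (w' * s'), Nat.zero_le (q' * s'), Nat.zero_le (w' ^ 2 * q'),
        Nat.zero_le (w' ^ 2 * s'), Nat.zero_le (w' ^ 2)]
    · by_contra h
      have : 0 < s' := by lia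
      nlinarith [Nat.zero_le (w' * q' * s'), Nat.zero_le (w' ^ 2 * q' * s'), Nat.zero_le (w' * q'),
        Nat.zero_le (w' * s'), Nat.zero_le (q' * s'), Nat.zero_le (w' ^ 2 * q'),
        Nat.zero_le (w' ^ 2 * s'), Nat.zero_le (w' ^ 2)]
  have hRsum : ∑ p ∈ R, (p - 1) = n ∧ ∏ p ∈ R, p = n + 1 := by
    lia
  by_cases hq3 : q = 3
  · subst hq3
    lia
  have h3n : ¬ 3 ∣ n := fun h => by
    have := Nat.prime_three.dvd_of_dvd_pow (hn ▸ h)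
    lia
  have h3q : ¬ 3 ∣ q := fun h => hq3 ((Nat.prime_dvd_prime_iff_eq Nat.prime_three hq).1 h).symm
  have h3 : 3 ∣ ∏ p ∈ R, p := by
    rw [hRsum.2]
    lia
  obtain ⟨p, hp, h3p⟩ := (Nat.prime_three.prime.dvd_finsetProd_iff _).1 h3
  obtain rfl : 3 = p := (Nat.prime_dvd_prime_iff_eq Nat.prime_three (hRp p hp)).1 h3p
  have h4 := Finset.add_sum_erase R (fun p => p - 1) hp
  have h5 := Finset.mul_prod_erase R (fun p => p) hp
  have h6 := (R.erase 3).sum_sub_one_lt_prod fun p hp => (hRp p (Finset.mem_of_mem_erase hp)).pos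
  lia

/-- A finite insoluble biminimal non-abelian group is isomorphic to $A_5$. -/
theorem stmt_6 {G : Type*} [Group G] [Finite G]
    (hinsol : ¬ IsSolvable G) (hbi : BiminimalNonAbelian G) :
    Nonempty (G ≃* ↥(alternatingGroup (Fin 5))) := by
  have hM := hbi.noncommutativeSubgroupsMaximal
  have hG : ¬ Group.IsSolvable G := hinsol
  have := hM.isSimpleGroup hG
  have := Fintype.ofFinite G
  have := Fact.mk Nat.prime_two
  have h2 : 2 ∣ Nat.card G := by
    by_contra h
    refine (hM.commTransitive hG).not_odd_card (hM.commutator_eq_top hG) ?_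
    rw [← Nat.card_eq_fintype_card, ← Nat.not_even_iff_odd, even_iff_two_dvd]
    exact h
  obtain ⟨S, q, w, k, P, hq, hw, hidx, hk, hcard, hP, hD⟩ := hM.exists_sylow_two hG h2
  obtain ⟨a, ha⟩ := IsPGroup.iff_card.1 S.isPGroup'
  have ha0 : a ≠ 0 := by
    rintro rfl
    exact S.ne_bot_of_dvd_card h2 (Subgroup.card_eq_one.1 (by rw [ha, pow_zero]))
  rw [hcard] at hP
  obtain ⟨h4, rfl, rfl⟩ := two_pow_eq_four_of_sum_eq ha ha0 hw hq hk hP hD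
  refine nonempty_mulEquiv_alternatingGroup
    (fun f x => hM.monoidHom_eq_one hG inferInstance f x) ?_ _ hidx
  rw [hcard, h4]
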